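/- Let k be a positive integer. If {8k², 8k²+1, c, d} is a D(-8k²)-quadruple of positive integers with c < d, then c = 1 and d = 32k²+1; moreover, in that case k is a term of the sequence (k_i) defined by k_1 = 1, k_2 = 10, k_{n+2} = 10·k_{n+1} − k_n. -/

import Mathlib

/-- The sequence `k₁ = 1, k₂ = 10, k_{n+2} = 10 k_{n+1} - k_n`
(here indexed from 0, so `kseq 0 = k₁`). -/
def kseq : ℕ → ℤ
  | 0 => 1
  | 1 => 10
  | n + 2 => 10 * kseq (n + 1) - kseq n

/-- Pell sequence pair `(Y_n, U_n)` for `Y² = 1 + (A²-1) U²`. -/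
def pp (A : ℤ) : ℕ → ℤ × ℤ
  | 0 => (1, 0)
  | n + 1 => (A * (pp A n).1 + (A ^ 2 - 1) * (pp A n).2, (pp A n).1 + A * (pp A n).2)

def py (A : ℤ) (n : ℕ) : ℤ := (pp A n).1
def pu (A : ℤ) (n : ℕ) : ℤ := (pp A n).2

lemma py_zero (A : ℤ) : py A 0 = 1 := rfl
lemma pu_zero (A : ℤ) : pu A 0 = 0 := rfl
lemma py_succ (A : ℤ) (n : ℕ) : py A (n + 1) = A * py A n + (A ^ 2 - 1) * pu A n := rfl
lemma pu_succ (A : ℤ) (n : ℕ) : pu A (n + 1) = py A n + A * pu A n := rfl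
lemma pu_one (A : ℤ) : pu A 1 = 1 := by simp [pu_succ, py_zero, pu_zero]
lemma py_one (A : ℤ) : py A 1 = A := by simp [py_succ, py_zero, pu_zero]

lemma pp_eq (A : ℤ) (n : ℕ) : py A n ^ 2 = 1 + (A ^ 2 - 1) * pu A n ^ 2 := by
  induction n with
  | zero => simp [py_zero, pu_zero]
  | succ n ih => rw [py_succ, pu_succ]; linear_combination ih

lemma pp_pos (A : ℤ) (hA : 2 ≤ A) (n : ℕ) : 1 ≤ py A n ∧ 0 ≤ pu A n := by
  induction n with
  | zero => simp [py_zero, pu_zero]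
  | succ n ih =>
    obtain ⟨h1, h2⟩ := ih
    rw [py_succ, pu_succ]
    have : 0 ≤ (A ^ 2 - 1) * pu A n := mul_nonneg (by nlinarith) h2
    have h3 : 0 ≤ A * pu A n := mul_nonneg (by linarith) h2
    constructor <;> nlinarith

lemma pu_strictMono (A : ℤ) (hA : 2 ≤ A) : StrictMono (pu A) := by
  apply strictMono_nat_of_lt_succ
  intro n
  obtain ⟨h1, h2⟩ := pp_pos A hA n
  rw [pu_succ]; nlinarith

lemma pp_add (A : ℤ) (m n : ℕ) :
    py A (m + n) = py A m * py A n + (A ^ 2 - 1) * pu A m * pu A n ∧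
    pu A (m + n) = pu A m * py A n + py A m * pu A n := by
  induction n with
  | zero => simp [py_zero, pu_zero]
  | succ n ih =>
    rw [← add_assoc, py_succ, pu_succ, py_succ, pu_succ]
    rw [ih.1, ih.2]
    constructor <;> ring

lemma pp_solve (A : ℤ) (hA : 2 ≤ A) : ∀ (b : ℕ) (Y U : ℤ), U ≤ b → 0 ≤ U → 0 ≤ Y →
    Y ^ 2 = 1 + (A ^ 2 - 1) * U ^ 2 → ∃ n, Y = py A n ∧ U = pu A n := by
  intro b
  induction b with
  | zero =>
    intro Y U h1 h2 h3 h
    have hU : U = 0 := by push_cast at h1; omega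
    subst hU
    exact ⟨0, by rw [py_zero]; nlinarith, rfl⟩
  | succ b ih =>
    intro Y U h1 h2 h3 h
    rcases h2.eq_or_lt with hU | hU
    · subst hU; exact ⟨0, by rw [py_zero]; nlinarith, rfl⟩
    have hYA : Y ≤ A * U := by
      apply abs_le_of_sq_le_sq' _ (by positivity) |>.2
      nlinarith
    have hYA2 : (A - 1) * U < Y := by
      apply lt_of_pow_lt_pow_left₀ 2 h3
      nlinarith [mul_pos hU hU]
    obtain ⟨n, hn1, hn2⟩ := ih (A * Y - (A ^ 2 - 1) * U) (A * U - Y)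
      (by push_cast at h1; linarith) (by linarith)
      (by
        have : 0 ≤ (A + 1) * (A * U - Y) := mul_nonneg (by linarith) (by linarith)
        by_contra hcon
        push Not at hcon
        have e1 : (A ^ 2 - 1) * U > A * Y := by linarith
        have e2 : ((A ^ 2 - 1) * U) ^ 2 > (A * Y) ^ 2 :=
          pow_lt_pow_left₀ e1 (by positivity) (by norm_num)
        have e3 : 0 ≤ (A ^ 2 - 1) * U ^ 2 := mul_nonneg (by nlinarith) (by positivity)
        have e4 : ((A ^ 2 - 1) * U) ^ 2 = (A^2-1) * ((A^2-1)*U^2) := by ring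
        have e5 : (A * Y) ^ 2 = A^2 * (1 + (A ^ 2 - 1) * U ^ 2) := by rw [← h]; ring
        nlinarith)
      (by linear_combination h)
    refine ⟨n + 1, ?_, ?_⟩
    · rw [py_succ, ← hn1, ← hn2]; ring
    · rw [pu_succ, ← hn1, ← hn2]; ring

lemma part1 (k c x y : ℤ) (hk : 0 < k) (hx : 8 * k ^ 2 * c - 8 * k ^ 2 = x ^ 2)
    (hy : (8 * k ^ 2 + 1) * c - 8 * k ^ 2 = y ^ 2) :
    ∃ j, c = 4 * (8 * k ^ 2) * pu (16 * k ^ 2 + 1) j ^ 2 + 1 := by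
  have hkx : k ∣ x := by
    rw [← Int.pow_dvd_pow_iff (n := 2) (by norm_num)]
    exact ⟨8 * (c - 1), by linear_combination -hx⟩
  obtain ⟨x', rfl⟩ := hkx
  have hx' : 8 * (c - 1) = x' ^ 2 := by
    have : k ^ 2 * (8 * (c - 1)) = k ^ 2 * x' ^ 2 := by linear_combination hx
    exact mul_left_cancel₀ (by positivity) this
  have h4 : (4 : ℤ) ∣ x' := by
    have h2 : (2 : ℤ) ∣ x' := by
      apply Int.prime_two.dvd_of_dvd_pow (n := 2)
      exact ⟨4 * (c - 1), by linarith⟩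
    obtain ⟨w, rfl⟩ := h2
    have h2 : (2 : ℤ) ∣ w := by
      apply Int.prime_two.dvd_of_dvd_pow (n := 2)
      exact ⟨(c - 1), by linarith⟩
    obtain ⟨v, rfl⟩ := h2
    exact ⟨v, by ring⟩
  obtain ⟨t, rfl⟩ := h4
  have hct : c = 2 * t ^ 2 + 1 := by linarith
  have key : ∀ (b : ℕ) (y t : ℤ), 0 ≤ t → t ≤ b → 0 ≤ y → y ^ 2 = 1 + (16 * k ^ 2 + 2) * t ^ 2 →
      4 * k ∣ t := by
    intro b
    induction b with
    | zero => intro y t h1 h2 _ _; have : t = 0 := by push_cast at h2; omega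
              simp [this]
    | succ b ih =>
      intro y t h1 h2 h3 h
      rcases h1.eq_or_lt with ht | ht
      · simp [← ht]
      have hlow : 4 * k * t < y := by
        apply lt_of_pow_lt_pow_left₀ 2 h3
        nlinarith
      rcases lt_or_ge t (4 * k) with hlt | hge
      · exfalso
        have : y < 4 * k * t + 1 := by
          apply lt_of_pow_lt_pow_left₀ 2 (by positivity)
          nlinarith
        omega
      · have hup : 4 * k * y ≤ (16 * k ^ 2 + 1) * t := by
          apply abs_le_of_sq_le_sq' _ (by positivity) |>.2
          nlinarith
        have hup2 : 16 * k ^ 2 * t < 4 * k * y := by nlinarith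
        have h16 : 4 * k * ((16 * k ^ 2 + 2) * t) ≤ (16 * k ^ 2 + 1) * y := by
          apply abs_le_of_sq_le_sq' _ (by positivity) |>.2
          have e5 : ((16 * k ^ 2 + 1) * y) ^ 2 = (16 * k ^ 2 + 1)^2 * (1 + (16 * k ^ 2 + 2) * t ^ 2) := by
            rw [← h]; ring
          rw [e5]
          nlinarith [sq_nonneg (k * t), sq_nonneg t, sq_nonneg k]
        have := ih ((16 * k ^ 2 + 1) * y - 4 * k * ((16 * k ^ 2 + 2) * t))
          ((16 * k ^ 2 + 1) * t - 4 * k * y) (by linarith)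
          (by push_cast at h2; linarith) (by linarith) (by linear_combination h)
        have h7 : t = ((16 * k ^ 2 + 1) * t - 4 * k * y) + 4 * k * (y - 4 * k * t) := by ring
        rw [h7]
        exact dvd_add this (dvd_mul_right _ _)
  have hy' : |y| ^ 2 = 1 + (16 * k ^ 2 + 2) * |t| ^ 2 := by
    rw [sq_abs, sq_abs, ← hy, hct]; ring
  obtain ⟨U, hU⟩ := key |t|.toNat |y| |t| (abs_nonneg _) (Int.self_le_toNat _) (abs_nonneg _) hy'
  have hU0 : 0 ≤ U := by
    by_contra hn
    push Not at hn
    have := abs_nonneg t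
    nlinarith
  obtain ⟨n, hn1, hn2⟩ := pp_solve (16 * k ^ 2 + 1) (by nlinarith) U.toNat |y| U (Int.self_le_toNat _)
    hU0 (abs_nonneg _) (by rw [hy', hU]; ring)
  refine ⟨n, ?_⟩
  rw [← hn2, hct, ← sq_abs t, hU]; ring

lemma sq_of_coprime_pos {a b c : ℤ} (h : IsCoprime a b) (heq : a * b = c ^ 2) (ha : 0 < a) :
    ∃ s, 0 < s ∧ a = s ^ 2 := by
  obtain ⟨s, hs | hs⟩ := Int.sq_of_isCoprime h heq
  · refine ⟨|s|, ?_, by rw [sq_abs, hs]⟩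
    rw [abs_pos]; rintro rfl; simp at hs; omega
  · nlinarith [sq_nonneg s]

lemma part2 (k z : ℤ) (hk : 0 < k) (j : ℕ) (hj : 1 ≤ j)
    (h : 4 * (8 * k ^ 2) * pu (16 * k ^ 2 + 1) j ^ 2 + 1 - 8 * k ^ 2 = z ^ 2) : j = 1 := by
  set A := 16 * k ^ 2 + 1 with hA
  have hA2 : 2 ≤ A := by nlinarith
  set N := 8 * k ^ 2 with hN
  have hNpos : 0 < N := by positivity
  have hAN : A = 2 * N + 1 := by rw [hA, hN]; ring
  have hAA : A ^ 2 - 1 = 4 * N * (N + 1) := by rw [hAN]; ring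
  set Y := py A j with hY
  have hYe := pp_eq A j
  rw [← hY, hAA] at hYe
  have hprod : (Y + N) * (Y - N) = (N + 1) * z ^ 2 := by rw [← h]; linear_combination hYe
  have hcop : IsCoprime (Y + N) (Y - N) := by
    have c1 : IsCoprime Y N := ⟨Y, -(4 * (N + 1) * pu A j ^ 2), by linear_combination hYe⟩
    have c2 : IsCoprime Y 2 := ⟨Y, -(2 * N * (N + 1) * pu A j ^ 2), by linear_combination hYe⟩
    have c3 : IsCoprime (Y + N) N := by simpa using c1.add_mul_left_left 1
    have c4 : IsCoprime (Y + N) 2 := by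
      have := c2.add_mul_left_left (4 * k ^ 2)
      have e : Y + N = Y + 2 * (4 * k ^ 2) := by rw [hN]; ring
      rwa [e]
    have c5 : IsCoprime (Y + N) (2 * N) := c4.mul_right c3
    have c6 := c5.neg_right.add_mul_left_right 1
    have e : Y - N = -(2 * N) + (Y + N) * 1 := by ring
    rwa [e]
  obtain ⟨n, hn⟩ := Nat.even_or_odd' j
  rcases hn with hn | hn
  · exfalso
    have hj2 : j = n + n := by omega
    have hYn : Y = 1 + 8 * N * (N + 1) * pu A n ^ 2 := by
      rw [hY, hj2, (pp_add A n n).1, hAA]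
      have := pp_eq A n
      rw [hAA] at this
      linear_combination this
    have e1 : Y + N = (N + 1) * (8 * N * pu A n ^ 2 + 1) := by rw [hYn]; ring
    have e2 : (8 * N * pu A n ^ 2 + 1) * (Y - N) = z ^ 2 := by
      have : (N + 1) * ((8 * N * pu A n ^ 2 + 1) * (Y - N)) = (N + 1) * z ^ 2 := by
        rw [← hprod, e1]; ring
      exact mul_left_cancel₀ (by positivity) this
    rw [e1] at hcop
    obtain ⟨s, hs, hs2⟩ := sq_of_coprime_pos hcop.of_mul_left_right e2 (by positivity)
    have hpos := (pp_pos A hA2 n).2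
    have hn1 : 1 ≤ n := by omega
    have hup : 0 < pu A n := by
      have := pu_strictMono A hA2 (show 0 < n by omega)
      rwa [pu_zero] at this
    set u := pu A n
    have hs3 : s ^ 2 = (8 * k * u) ^ 2 + 1 := by rw [← hs2, hN]; ring
    have : 8 * k * u < s := lt_of_pow_lt_pow_left₀ 2 hs.le (by linarith)
    have : 0 < k * u := by positivity
    nlinarith
  · have hj2 : j = n + (n + 1) := by omega
    set u := pu A n with hu
    set y := py A n with hy
    have hye := pp_eq A n
    rw [← hu, ← hy, hAA] at hye
    have hpos := pp_pos A hA2 n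
    rw [← hu, ← hy] at hpos
    obtain ⟨hy1, hu0⟩ := hpos
    set V := y + 2 * (N + 1) * u with hV
    set W := y + 2 * N * u with hW
    have hVW : (N + 1) * W ^ 2 - N * V ^ 2 = 1 := by rw [hV, hW]; linear_combination hye
    have hYj : Y = 2 * N * V ^ 2 + 1 := by
      rw [hY, hj2, (pp_add A n (n + 1)).1, hAA, py_succ, pu_succ, hAA, ← hu, ← hy, hAN, hV]
      linear_combination hye
    have hW1 : 1 ≤ W := by nlinarith
    have e1 : Y - N = (N + 1) * (2 * W ^ 2 - 1) := by rw [hYj]; linear_combination -2 * hVW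
    have e2 : (Y + N) * (2 * W ^ 2 - 1) = z ^ 2 := by
      have : (N + 1) * ((Y + N) * (2 * W ^ 2 - 1)) = (N + 1) * z ^ 2 := by
        rw [← hprod, e1]; ring
      exact mul_left_cancel₀ (by positivity) this
    rw [e1] at hcop
    obtain ⟨s, hs, hs2⟩ := sq_of_coprime_pos hcop.of_mul_right_right e2 (by rw [hYj]; positivity)
    have hV1 : 1 ≤ V := by nlinarith
    have hs3 : s ^ 2 = (4 * k * V) ^ 2 + 8 * k ^ 2 + 1 := by rw [← hs2, hYj, hN]; ring
    have hs4 : 4 * k * V < s := lt_of_pow_lt_pow_left₀ 2 hs.le (by nlinarith)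
    have hVk : V ≤ k := by
      have h1 : (4 * k * V + 1) ^ 2 ≤ s ^ 2 := pow_le_pow_left₀ (by positivity) (by omega) 2
      have h2 : k * V ≤ k * k := by nlinarith
      exact le_of_mul_le_mul_left h2 hk
    have hWV : V = W + 2 * u := by rw [hV, hW]; ring
    by_contra hj1
    have hn1 : 0 < n := by omega
    have hup : 0 < u := by
      have := pu_strictMono A hA2 hn1
      rwa [pu_zero] at this
    have f1 : N * (V ^ 2 - W ^ 2) = W ^ 2 - 1 := by linear_combination -hVW
    have f2 : 1 ≤ V ^ 2 - W ^ 2 := by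
      have : V ^ 2 - W ^ 2 = 2 * u * (V + W) := by rw [hWV]; ring
      rw [this]
      have : 0 < 2 * u * (V + W) := by positivity
      omega
    have f3 : N ≤ N * (V ^ 2 - W ^ 2) := le_mul_of_one_le_right hNpos.le f2
    have f4 : V ^ 2 ≤ k ^ 2 := pow_le_pow_left₀ (by omega) hVk 2
    have f5 : 0 < k ^ 2 := by positivity
    linarith

lemma pu_congr (A : ℤ) (i : ℕ) (hi : 1 ≤ i) : ∀ b j : ℕ, j ≤ b →
    ∃ r ≤ i, ∃ q : ℤ, pu A j = pu A r + 2 * pu A i * q ∨ pu A j = -pu A r + 2 * pu A i * q := by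
  intro b
  induction b with
  | zero => intro j hj; exact ⟨j, by omega, 0, Or.inl (by ring)⟩
  | succ b ih =>
    intro j hj
    rcases le_or_gt j i with h1 | h1
    · exact ⟨j, h1, 0, Or.inl (by ring)⟩
    rcases le_or_gt j (2 * i) with h2 | h2
    · obtain ⟨s, rfl⟩ := Nat.exists_eq_add_of_lt h1
      obtain ⟨r, hr⟩ := Nat.exists_eq_add_of_le (show s + 1 ≤ i by omega)
      refine ⟨r, by omega, py A (s + 1), Or.inr ?_⟩
      have e : i + s + 1 = (r + (s + 1)) + (s + 1) := by omega
      have e' : i = r + (s + 1) := by omega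
      rw [e, e', (pp_add A (r + (s + 1)) (s + 1)).2, (pp_add A r (s + 1)).2, (pp_add A r (s + 1)).1]
      linear_combination (- pu A r) * pp_eq A (s + 1)
    · obtain ⟨q, rfl⟩ := Nat.exists_eq_add_of_lt h2
      obtain ⟨r, hr, t, ht⟩ := ih (q + 1) (by omega)
      have e : pu A (2 * i + q + 1) = pu A (q + 1) + 2 * pu A i * py A (i + (q + 1)) := by
        have e1 : 2 * i + q + 1 = i + (i + (q + 1)) := by omega
        rw [e1, (pp_add A i (i + (q + 1))).2, (pp_add A i (q + 1)).2, (pp_add A i (q + 1)).1]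
        linear_combination (pu A (q + 1)) * pp_eq A i
      refine ⟨r, hr, t + py A (i + (q + 1)), ?_⟩
      rcases ht with ht | ht
      · left; rw [e, ht]; ring
      · right; rw [e, ht]; ring

lemma desc3 (N u c : ℤ) (hN : 0 < N) (hu : 1 ≤ u) (hc : c = 4 * N * u ^ 2 + 1) :
    ∀ (b : ℕ) (V z : ℤ), 0 ≤ V → V ≤ b → z ^ 2 = 4 * N * c * V ^ 2 + c - N →
    ∃ V0 z0 q : ℤ, 0 ≤ V0 ∧ V0 < u ∧ z0 ^ 2 = 4 * N * c * V0 ^ 2 + c - N ∧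
      (V = V0 + 2 * u * q ∨ V = - V0 + 2 * u * q) := by
  intro b
  induction b with
  | zero =>
    intro V z h0 hb hz
    exact ⟨V, z, 0, h0, by push_cast at hb; omega, hz, Or.inl (by ring)⟩
  | succ b ih =>
    intro V z h0 hb hz
    rcases lt_or_ge V u with hV | hV
    · exact ⟨V, z, 0, h0, hV, hz, Or.inl (by ring)⟩
    have hcN : 0 < c - N := by
      have h1 : 1 ≤ u ^ 2 := one_le_pow₀ hu
      have h2 : N * 1 ≤ N * u ^ 2 := mul_le_mul_of_nonneg_left h1 hN.le
      rw [hc]; linarith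
    have hcpos : 0 < c := by linarith
    have hz' : |z| ^ 2 = 4 * N * c * V ^ 2 + c - N := by rw [sq_abs, hz]
    have hznn := abs_nonneg z
    generalize |z| = w at hz' hznn
    have hVp : 0 < V := by linarith
    have l1 : 4 * N * u * V < w := by
      apply lt_of_pow_lt_pow_left₀ 2 hznn
      rw [hz']
      have : 4 * N * c * V ^ 2 = (4 * N * u * V) ^ 2 + 4 * N * V ^ 2 := by rw [hc]; ring
      have : 0 < 4 * N * V ^ 2 := by positivity
      linarith
    have l2 : u * w < c * V := by
      apply lt_of_pow_lt_pow_left₀ 2 (by positivity)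
      have e1 : (u * w) ^ 2 = u ^ 2 * (4 * N * c * V ^ 2 + c - N) := by rw [← hz']; ring
      have e2 : (c * V) ^ 2 = c * V ^ 2 * (4 * N * u ^ 2 + 1) := by rw [← hc]; ring
      rw [e1, e2]
      have : u ^ 2 ≤ V ^ 2 := pow_le_pow_left₀ (by omega) hV 2
      have h3 : u ^ 2 * c ≤ V ^ 2 * c := mul_le_mul_of_nonneg_right this hcpos.le
      have h4 : 0 < u ^ 2 * N := by positivity
      linarith
    have hq : 2 * u * w > (2 * c - 2) * V := by
      rw [hc]; have := mul_lt_mul_of_pos_left l1 (show 0 < 2 * u by linarith); linarith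
    have hb1 : |(2 * c - 1) * V - 2 * u * w| ≤ b := by
      push_cast at hb
      rw [abs_le]; constructor <;> linarith
    obtain ⟨V0, z0, q, h1, h2, h3, h4⟩ := ih |(2 * c - 1) * V - 2 * u * w|
      ((2 * c - 1) * w - 8 * u * N * c * V) (abs_nonneg _) hb1 (by
        rw [sq_abs]
        have : u ^ 2 * (4 * N) = c - 1 := by rw [hc]; ring
        linear_combination (hz') + 4 * c * (4 * N * c * V ^ 2 - w ^ 2) * this)
    rcases abs_choice ((2 * c - 1) * V - 2 * u * w) with h5 | h5
    · rw [h5] at h4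
      rcases h4 with h4 | h4
      · exact ⟨V0, z0, q + w - 4 * N * u * V, h1, h2, h3, Or.inl (by rw [hc] at h4; linear_combination h4)⟩
      · exact ⟨V0, z0, q + w - 4 * N * u * V, h1, h2, h3, Or.inr (by rw [hc] at h4; linear_combination h4)⟩
    · rw [h5] at h4
      rcases h4 with h4 | h4
      · exact ⟨V0, z0, -q + w - 4 * N * u * V, h1, h2, h3, Or.inr (by rw [hc] at h4; linear_combination -h4)⟩
      · exact ⟨V0, z0, -q + w - 4 * N * u * V, h1, h2, h3, Or.inl (by rw [hc] at h4; linear_combination -h4)⟩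

def PP (N : ℤ) (i j : ℕ) : Prop :=
  ∃ z : ℤ, (4 * N * pu (2 * N + 1) i ^ 2 + 1) * (4 * N * pu (2 * N + 1) j ^ 2 + 1) - N = z ^ 2

lemma eq_of_congr (u a b q : ℤ) (ha : 0 ≤ a) (hau : a < u) (hb : 0 ≤ b) (hbu : b ≤ u)
    (h : a = b + 2 * u * q ∨ a = - b + 2 * u * q) : a = b := by
  rcases lt_trichotomy q 0 with hq | hq | hq
  · rcases h with h | h <;> nlinarith
  · subst hq; rcases h with h | h <;> omega
  · rcases h with h | h <;> nlinarith

lemma part3 (N : ℤ) (hN : 0 < N) (i j : ℕ) (hi : 1 ≤ i) (h : PP N i j) :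
    ∃ r < i, PP N r i := by
  obtain ⟨z, hz⟩ := h
  have hA : 2 ≤ 2 * N + 1 := by omega
  set A := 2 * N + 1 with hAdef
  have hu : 1 ≤ pu A i := by
    have := pu_strictMono A hA (show 0 < i by omega)
    rw [pu_zero] at this; omega
  have hUj := (pp_pos A hA j).2
  obtain ⟨V0, z0, q, h1, h2, h3, h4⟩ := desc3 N (pu A i) _ hN hu rfl (pu A j).toNat (pu A j) z hUj
    (Int.self_le_toNat _) (by rw [← hz]; ring)
  obtain ⟨r, hr, q', h5⟩ := pu_congr A i hi j j le_rfl
  have hle : pu A r ≤ pu A i := (pu_strictMono A hA).monotone hr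
  have hr0 := (pp_pos A hA r).2
  have key : V0 = pu A r := by
    rcases h4 with h4 | h4 <;> rcases h5 with h5 | h5
    · exact eq_of_congr (pu A i) V0 (pu A r) (q' - q) h1 h2 hr0 hle (Or.inl (by linarith))
    · exact eq_of_congr (pu A i) V0 (pu A r) (q' - q) h1 h2 hr0 hle (Or.inr (by linarith))
    · exact eq_of_congr (pu A i) V0 (pu A r) (q - q') h1 h2 hr0 hle (Or.inr (by linarith))
    · exact eq_of_congr (pu A i) V0 (pu A r) (q - q') h1 h2 hr0 hle (Or.inl (by linarith))
  refine ⟨r, ?_, z0, ?_⟩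
  · rw [key] at h2
    exact (pu_strictMono A hA).lt_iff_lt.1 h2
  · rw [h3, key]; ring

lemma part3' (k : ℤ) (hk : 0 < k) : ∀ b i j : ℕ, i ≤ b → 1 ≤ i → i < j → PP (8 * k ^ 2) i j →
    PP (8 * k ^ 2) 0 1 ∧ ∃ j, 2 ≤ j ∧ PP (8 * k ^ 2) 1 j := by
  intro b
  induction b with
  | zero => intro i j h1 h2; omega
  | succ b ih =>
    intro i j hb hi hij h
    obtain ⟨r, hr, hP⟩ := part3 _ (by positivity) i j hi h
    rcases Nat.eq_zero_or_pos r with h0 | h0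
    · subst h0
      have hi1 : i = 1 := by
        obtain ⟨z, hz⟩ := hP
        apply part2 k z hk i hi
        rw [← hz, pu_zero]; ring_nf
      subst hi1
      exact ⟨hP, j, by omega, h⟩
    · exact ih r i (by omega) h0 hr hP

lemma desc4 (N c z0 : ℤ) (hN : 0 < N) (hc : c = 4 * N + 1) (h0 : z0 ^ 2 = 3 * N + 1) :
    ∀ (b : ℕ) (V z : ℤ), 0 ≤ V → V ≤ b → z ^ 2 = 4 * N * c * V ^ 2 + z0 ^ 2 →
    2 * z0 ∣ V ∧ z0 ∣ z := by
  intro b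
  have key : ∀ V z : ℤ, z ^ 2 = 4 * N * c * V ^ 2 + z0 ^ 2 → 2 * z0 ∣ V → z0 ∣ z := by
    rintro V z hz ⟨s, rfl⟩
    rw [← Int.pow_dvd_pow_iff (n := 2) (by norm_num), hz]
    exact ⟨16 * N * c * s ^ 2 + 1, by ring⟩
  induction b with
  | zero =>
    intro V z h0 hb hz
    have : 2 * z0 ∣ V := by
      have : V = 0 := by push_cast at hb; omega
      simp [this]
    exact ⟨this, key _ _ hz this⟩
  | succ b ih =>
    intro V z hV hb hz
    have hcpos : 0 < c := by linarith
    have hz' : |z| ^ 2 = 4 * N * c * V ^ 2 + z0 ^ 2 := by rw [sq_abs, hz]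
    have hznn := abs_nonneg z
    suffices 2 * z0 ∣ V from ⟨this, key _ _ hz this⟩
    generalize |z| = w at hz' hznn
    rcases hV.eq_or_lt with hVp | hVp
    · simp [← hVp]
    have l1 : 4 * N * V < w := by
      apply lt_of_pow_lt_pow_left₀ 2 hznn
      rw [hz', h0]
      have : 4 * N * c * V ^ 2 = (4 * N * V) ^ 2 + 4 * N * V ^ 2 := by rw [hc]; ring
      have : 0 < 4 * N * V ^ 2 := by positivity
      linarith
    have l2 : w < c * V := by
      apply lt_of_pow_lt_pow_left₀ 2 (by positivity)
      have e2 : (c * V) ^ 2 = c * V ^ 2 * (4 * N + 1) := by rw [← hc]; ring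
      rw [hz', e2, h0]
      have : 1 ≤ V ^ 2 := one_le_pow₀ (by omega)
      have h3 : 1 * c ≤ V ^ 2 * c := mul_le_mul_of_nonneg_right this hcpos.le
      linarith
    have hb1 : |(2 * c - 1) * V - 2 * w| ≤ b := by
      push_cast at hb
      rw [abs_le, hc]; rw [hc] at l2; constructor <;> linarith
    have hrec := ih |(2 * c - 1) * V - 2 * w| ((2 * c - 1) * w - 8 * N * c * V) (abs_nonneg _) hb1 (by
        rw [sq_abs]
        have : (4 * N) = c - 1 := by rw [hc]; ring
        linear_combination (hz') + 4 * c * (4 * N * c * V ^ 2 - w ^ 2) * this)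
    rw [dvd_abs] at hrec
    have e : V = (2 * c - 1) * ((2 * c - 1) * V - 2 * w) + 2 * ((2 * c - 1) * w - 8 * N * c * V) := by
      rw [hc]; ring
    rw [e]
    exact dvd_add (hrec.1.mul_left _) (mul_dvd_mul_left 2 hrec.2)

lemma pu_parity (A : ℤ) (hA : A % 2 = 1) (n : ℕ) :
    py A n % 2 = 1 ∧ pu A n % 2 = (n : ℤ) % 2 := by
  induction n with
  | zero => simp [py_zero, pu_zero]
  | succ n ih =>
    obtain ⟨a, ha⟩ : ∃ a, A = 2 * a + 1 := ⟨A / 2, by omega⟩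
    rw [py_succ, pu_succ]
    constructor
    · have : A * py A n + (A ^ 2 - 1) * pu A n =
        py A n + 2 * (a * py A n + (2 * a ^ 2 + 2 * a) * pu A n) := by
        have h1 : A * py A n + (A ^ 2 - 1) * pu A n =
          (2 * a + 1) * py A n + ((2 * a + 1) ^ 2 - 1) * pu A n := by rw [← ha]
        rw [h1]; ring
      rw [this]; omega
    · have : A * pu A n = pu A n + 2 * (a * pu A n) := by
        have h1 : A * pu A n = (2 * a + 1) * pu A n := by rw [← ha]
        rw [h1]; ring
      rw [this]; push_cast; omega

lemma part4 (N : ℤ) (hN : 0 < N) (j : ℕ) (hj : 1 ≤ j) (h01 : PP N 0 1) (h : PP N 1 j) :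
    ∃ z0 : ℤ, 0 < z0 ∧ z0 ^ 2 = 3 * N + 1 ∧ ∃ n m : ℕ, 1 ≤ m ∧
      pu (2 * N + 1) (2 * n) = 2 * z0 * pu (8 * N + 1) m := by
  obtain ⟨z1, hz1⟩ := h01
  obtain ⟨z, hz⟩ := h
  rw [pu_zero, pu_one] at hz1
  rw [pu_one] at hz
  have h0 : |z1| ^ 2 = 3 * N + 1 := by rw [sq_abs, ← hz1]; ring
  have hz0 : 0 < |z1| := by
    rcases (abs_nonneg z1).eq_or_lt with h2 | h2
    · rw [← h2] at h0; nlinarith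
    · exact h2
  generalize |z1| = z0 at h0 hz0
  refine ⟨z0, hz0, h0, ?_⟩
  have hA : 2 ≤ 2 * N + 1 := by omega
  have hUj := (pp_pos (2 * N + 1) hA j).2
  have hUpos : 0 < pu (2 * N + 1) j := by
    have := pu_strictMono (2 * N + 1) hA (show 0 < j by omega)
    rwa [pu_zero] at this
  have heq : z ^ 2 = 4 * N * (4 * N + 1) * pu (2 * N + 1) j ^ 2 + z0 ^ 2 := by rw [h0, ← hz]; ring
  obtain ⟨⟨S, hS⟩, ⟨T, hT⟩⟩ := desc4 N _ z0 hN rfl h0 (pu (2 * N + 1) j).toNat (pu (2 * N + 1) j) z hUj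
    (Int.self_le_toNat _) heq
  have hSpos : 0 < S := by
    rw [hS] at hUpos
    exact pos_of_mul_pos_right hUpos (by positivity)
  have hTS : |T| ^ 2 = 1 + ((8 * N + 1) ^ 2 - 1) * S ^ 2 := by
    rw [hS, hT] at heq
    have : z0 ^ 2 * T ^ 2 = z0 ^ 2 * (1 + ((8 * N + 1) ^ 2 - 1) * S ^ 2) := by
      linear_combination heq
    rw [sq_abs]
    exact mul_left_cancel₀ (by positivity) this
  obtain ⟨m, hm1, hm2⟩ := pp_solve (8 * N + 1) (by omega) S.toNat |T| S (Int.self_le_toNat _)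
    hSpos.le (abs_nonneg _) hTS
  have hpar := (pu_parity (2 * N + 1) (by omega) j).2
  have hje : j = 2 * (j / 2) := by
    rw [hS] at hpar
    have : 2 * z0 * S = 2 * (z0 * S) := by ring
    rw [this] at hpar
    omega
  refine ⟨j / 2, m, ?_, ?_⟩
  · rcases Nat.eq_zero_or_pos m with h | h
    · subst h; rw [pu_zero] at hm2; omega
    · exact h
  · rw [← hje, hS, hm2]

lemma kseq_eq_pu (i : ℕ) : kseq i = pu 5 (i + 1) ∧ kseq (i + 1) = pu 5 (i + 2) := by
  induction i with
  | zero =>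
    constructor
    · rw [pu_one]; rfl
    · rw [pu_succ, py_one, pu_one]; rfl
  | succ n ih =>
    refine ⟨ih.2, ?_⟩
    have : kseq (n + 1 + 1) = 10 * kseq (n + 1) - kseq n := by rw [kseq]
    rw [this, ih.1, ih.2]
    rw [pu_succ 5 (n + 2), py_succ 5 (n + 1), pu_succ 5 (n + 1)]
    ring

lemma kseq_of_sq (k z : ℤ) (hk : 0 < k) (h : z ^ 2 = 24 * k ^ 2 + 1) : ∃ i : ℕ, k = kseq i := by
  obtain ⟨n, _, hn2⟩ := pp_solve 5 (by norm_num) k.toNat |z| k (Int.self_le_toNat _) hk.le (abs_nonneg _)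
    (by rw [sq_abs, h]; ring)
  rcases n with _ | n
  · rw [pu_zero] at hn2; omega
  · exact ⟨n, by rw [hn2, (kseq_eq_pu n).1]⟩

lemma small_k (k z : ℤ) (hk : 0 < k) (h : z ^ 2 = 24 * k ^ 2 + 1) (hs : k < 99) : k = 1 ∨ k = 10 := by
  obtain ⟨i, hi⟩ := kseq_of_sq k z hk h
  rcases i with _ | _ | i
  · left; rw [hi]; rfl
  · right; rw [hi]; rfl
  · exfalso
    rw [(kseq_eq_pu (i + 2)).1] at hi
    have h1 : pu 5 3 = 99 := by
      norm_num [pu_succ, py_succ, pu_zero, py_zero]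
    have : pu 5 3 ≤ pu 5 (i + 2 + 1) := (pu_strictMono 5 (by norm_num)).monotone (by omega)
    omega

theorem assemble (k c d : ℤ) (hk : 0 < k) (hc : 0 < c) (hcd : c < d)
    (h1c : ∃ x : ℤ, 8 * k ^ 2 * c - 8 * k ^ 2 = x ^ 2)
    (h2c : ∃ x : ℤ, (8 * k ^ 2 + 1) * c - 8 * k ^ 2 = x ^ 2)
    (h1d : ∃ x : ℤ, 8 * k ^ 2 * d - 8 * k ^ 2 = x ^ 2)
    (h2d : ∃ x : ℤ, (8 * k ^ 2 + 1) * d - 8 * k ^ 2 = x ^ 2)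
    (hcd' : ∃ x : ℤ, c * d - 8 * k ^ 2 = x ^ 2)
    (Q : ∀ (z0 : ℤ) (n m : ℕ), 0 < z0 → z0 ^ 2 = 3 * (8 * k ^ 2) + 1 → 1 ≤ m →
      pu (2 * (8 * k ^ 2) + 1) (2 * n) = 2 * z0 * pu (8 * (8 * k ^ 2) + 1) m → False) :
    c = 1 ∧ d = 32 * k ^ 2 + 1 ∧ ∃ i : ℕ, k = kseq i := by
  obtain ⟨x1, h1⟩ := h1c
  obtain ⟨x2, h2⟩ := h2c
  obtain ⟨x3, h3⟩ := h1d
  obtain ⟨x4, h4⟩ := h2d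
  obtain ⟨x5, h5⟩ := hcd'
  obtain ⟨i, hi⟩ := part1 k c x1 x2 hk h1 h2
  obtain ⟨j, hj⟩ := part1 k d x3 x4 hk h3 h4
  have eA : 16 * k ^ 2 + 1 = 2 * (8 * k ^ 2) + 1 := by ring
  have hA : 2 ≤ 16 * k ^ 2 + 1 := by nlinarith
  have hij : i < j := by
    by_contra hcon
    push Not at hcon
    have h6 := (pu_strictMono _ hA).monotone hcon
    have h7 := (pp_pos _ hA j).2
    have h8 := pow_le_pow_left₀ h7 h6 2
    have h9 : 0 ≤ 4 * (8 * k ^ 2) := by positivity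
    have := mul_le_mul_of_nonneg_left h8 h9
    linarith
  have hP : PP (8 * k ^ 2) i j := by
    refine ⟨x5, ?_⟩
    rw [← eA, ← hi, ← hj, h5]
  rcases Nat.eq_zero_or_pos i with h0 | h0
  · subst h0
    rw [pu_zero] at hi
    have hc1 : c = 1 := by rw [hi]; ring
    rw [hc1, hj] at h5
    have hj1 := part2 k x5 hk j (by omega) (by rw [← h5]; ring)
    rw [hj1, pu_one] at hj h5
    refine ⟨hc1, by rw [hj]; ring, kseq_of_sq k x5 hk (by rw [← h5]; ring)⟩
  · exfalso
    obtain ⟨h6, j', hj', h7⟩ := part3' k hk i i j le_rfl h0 hij hP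
    obtain ⟨z0, hz0, hz, n, m, hm, he⟩ := part4 (8 * k ^ 2) (by positivity) j' (by omega) h6 h7
    exact Q z0 n m hz0 hz hm he

lemma five_b (k z0 : ℤ) (hk : 0 < k) (n m : ℕ) (hz : z0 ^ 2 = 3 * (8 * k ^ 2) + 1)
    (hm : 1 ≤ m) (h3 : (3 : ℤ) ∣ 8 * k ^ 2 + 1)
    (h : pu (2 * (8 * k ^ 2) + 1) (2 * n) = 2 * z0 * pu (8 * (8 * k ^ 2) + 1) m) :
    ∃ X g : ℤ, 0 < X ∧ g ≠ 0 ∧ (8 * (8 * k ^ 2) ∣ X - 1) ∧ (4 * (8 * k ^ 2) + 1 ∣ X - 1) ∧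
      X ^ 2 - 1 = 64 * (8 * k ^ 2) ^ 2 * (8 * k ^ 2 + 1) * (4 * (8 * k ^ 2) + 1) * z0 ^ 2 * g ^ 4 := by
  set N := 8 * k ^ 2 with hN
  have hNpos : 0 < N := by positivity
  set S := pu (8 * N + 1) m with hS
  set T := py (8 * N + 1) m with hT
  set Y := py (2 * N + 1) (2 * n) with hY
  have hSpos : 0 < S := by
    have := pu_strictMono (8 * N + 1) (by omega) (show 0 < m by omega)
    rwa [pu_zero] at this
  have hTpos : 1 ≤ T := (pp_pos (8 * N + 1) (by omega) m).1
  have hYpos : 1 ≤ Y := (pp_pos (2 * N + 1) (by omega) (2 * n)).1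
  have hTe : T ^ 2 = 1 + 16 * N * (4 * N + 1) * S ^ 2 := by
    rw [hT, pp_eq, ← hS]; ring
  have hYe : Y ^ 2 = 1 + 16 * N * (N + 1) * z0 ^ 2 * S ^ 2 := by
    rw [hY, pp_eq, h]; ring
  have hYm : ∃ u, Y = 1 + 8 * N * (N + 1) * u ^ 2 := by
    refine ⟨pu (2 * N + 1) n, ?_⟩
    rw [hY, two_mul n, (pp_add _ n n).1]
    linear_combination pp_eq (2 * N + 1) n
  obtain ⟨u, hu⟩ := hYm
  have hTm : ∃ t, T = 1 + 8 * N * t := by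
    have : ∀ m, ∃ t, py (8 * N + 1) m = 1 + 8 * N * t := by
      intro m
      induction m with
      | zero => exact ⟨0, by rw [py_zero]; ring⟩
      | succ m ih =>
        obtain ⟨t, ht⟩ := ih
        exact ⟨t + py (8 * N + 1) m + 2 * (4 * N + 1) * pu (8 * N + 1) m, by
          rw [py_succ]; linear_combination ht⟩
    exact this m
  obtain ⟨t, ht⟩ := hTm
  have hTc : ∃ t, T = 1 + (4 * N + 1) * t ∨ T = -1 + (4 * N + 1) * t := by
    have : ∀ m, ∃ t, py (8 * N + 1) m = 1 + (4 * N + 1) * t ∨ py (8 * N + 1) m = -1 + (4 * N + 1) * t := by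
      intro m
      induction m with
      | zero => exact ⟨0, Or.inl (by rw [py_zero]; ring)⟩
      | succ m ih =>
        obtain ⟨t, ht⟩ := ih
        refine ⟨-t + 2 * py (8 * N + 1) m + 16 * N * pu (8 * N + 1) m, ?_⟩
        rcases ht with ht | ht
        · right; rw [py_succ]; linear_combination -ht
        · left; rw [py_succ]; linear_combination -ht
    exact this m
  have hdiff : Y ^ 2 - T ^ 2 = 48 * N ^ 3 * S ^ 2 := by
    rw [hYe, hTe, hz]; ring
  have hYT : T < Y := by
    apply lt_of_pow_lt_pow_left₀ 2 (by linarith)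
    have : 0 < 48 * N ^ 3 * S ^ 2 := by positivity
    linarith
  -- half sum and difference
  set P := 1 + 4 * N * ((N + 1) * u ^ 2 + t) with hP
  set M := 4 * N * ((N + 1) * u ^ 2 - t) with hM
  have eY : Y = P + M := by rw [hu, hP, hM]; ring
  have eT : T = P - M := by rw [ht, hP, hM]; ring
  have hPM : P * M = 6 * (32 * k ^ 3 * S) ^ 2 := by
    have h1 : 4 * (P * M) = 4 * (6 * (32 * k ^ 3 * S) ^ 2) := by
      have : 4 * (P * M) = Y ^ 2 - T ^ 2 := by rw [eY, eT]; ring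
      rw [this, hdiff, hN]; ring
    linarith
  have hPpos : 0 < P := by omega
  have hMpos : 0 < M := by omega
  obtain ⟨e3, he3⟩ := h3
  have hcop : IsCoprime P M := by
    have c3 : IsCoprime T 3 := ⟨T, -(16 * N * (4 * e3 - 1) * S ^ 2), by
      have : 4 * N + 1 = 3 * (4 * e3 - 1) := by linarith
      rw [this] at hTe
      linear_combination hTe⟩
    have c1 : IsCoprime T (16 * N * S ^ 2) := ⟨T, -((4 * N + 1)), by linear_combination hTe⟩
    have cN : IsCoprime T N := c1.of_mul_right_left.of_mul_right_right
    have cS : IsCoprime T (S ^ 2) := c1.of_mul_right_right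
    have c16 : IsCoprime T 16 := c1.of_mul_right_left.of_mul_right_left
    have c48 : IsCoprime T (48 * N ^ 3 * S ^ 2) := by
      have : (48 : ℤ) = 16 * 3 := by norm_num
      rw [this]
      exact ((c16.mul_right c3).mul_right cN.pow_right).mul_right cS
    have c5 : IsCoprime T (Y ^ 2) := by
      have := c48.add_mul_left_right T
      have e : Y ^ 2 = 48 * N ^ 3 * S ^ 2 + T * T := by rw [← hdiff]; ring
      rwa [e]
    have c6 : IsCoprime T Y := (IsCoprime.pow_right_iff (by norm_num)).1 c5
    obtain ⟨a, b, hab⟩ := c6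
    refine ⟨a + b, b - a, ?_⟩
    rw [eY, eT] at hab
    linear_combination hab
  obtain ⟨M', hM'⟩ : (2 : ℤ) ∣ M := ⟨2 * N * ((N + 1) * u ^ 2 - t), by rw [hM]; ring⟩
  have hPM' : P * M' = 3 * (32 * k ^ 3 * S) ^ 2 := by
    rw [hM'] at hPM; linarith
  have hcop' : IsCoprime P M' := by rw [hM'] at hcop; exact hcop.of_mul_right_right
  have h3' : (3 : ℤ) ∣ P ∨ (3 : ℤ) ∣ M' := by
    apply Int.prime_three.dvd_or_dvd
    rw [hPM']; exact dvd_mul_right _ _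
  have h8P : ∃ w, P = 1 + 8 * w := ⟨4 * k ^ 2 * ((N + 1) * u ^ 2 + t), by rw [hP, hN]; ring⟩
  obtain ⟨w8, hw8⟩ := h8P
  obtain ⟨M2, hM2⟩ : (3 : ℤ) ∣ M' := by
    rcases h3' with h3' | h3'
    · exfalso
      obtain ⟨P', hP'⟩ := h3'
      have e1 : P' * M' = (32 * k ^ 3 * S) ^ 2 := by rw [hP'] at hPM'; linarith
      have c2 : IsCoprime P' M' := by rw [hP'] at hcop'; exact hcop'.of_mul_left_right
      obtain ⟨s, hs, hs2⟩ := sq_of_coprime_pos c2 e1 (by omega)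
      rw [hs2, hw8] at hP'
      have h9 := congrArg (Int.cast : ℤ → ZMod 8) hP'
      push_cast at h9
      have h10 : ∀ a b : ZMod 8, 1 + 8 * a ≠ 3 * b ^ 2 := by decide
      exact h10 _ _ h9
    · exact h3'
  have e1 : P * M2 = (32 * k ^ 3 * S) ^ 2 := by rw [hM2] at hPM'; linarith
  have c2 : IsCoprime P M2 := by rw [hM2] at hcop'; exact hcop'.of_mul_right_right
  obtain ⟨f, hf, hf2⟩ := sq_of_coprime_pos c2 e1 hPpos
  obtain ⟨g0, hg0, hg2⟩ := sq_of_coprime_pos c2.symm (by rw [mul_comm]; exact e1) (show 0 < M2 by omega)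
  have hfg : f * g0 = 32 * k ^ 3 * S := by
    have : (f * g0) ^ 2 = (32 * k ^ 3 * S) ^ 2 := by rw [← e1, hf2, hg2]; ring
    exact (pow_left_inj₀ (by positivity) (by positivity) (by norm_num)).1 this
  have hfc : IsCoprime f (32 * k ^ 3) := by
    have c1 : IsCoprime f (32 * k ^ 2) := ⟨f, -((N + 1) * u ^ 2 + t), by
      rw [hf2] at hP; rw [hN] at hP ⊢; linear_combination hP⟩
    have c3 : IsCoprime f k := (IsCoprime.pow_right_iff (by norm_num)).1 c1.of_mul_right_right
    exact c1.of_mul_right_left.mul_right c3.pow_right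
  obtain ⟨g, hg⟩ : 32 * k ^ 3 ∣ g0 := hfc.symm.dvd_of_dvd_mul_left ⟨S, hfg⟩
  have hSfg : S = f * g := by
    have : 32 * k ^ 3 * S = 32 * k ^ 3 * (f * g) := by rw [← hfg, hg]; ring
    exact mul_left_cancel₀ (by positivity) this
  have hgpos : 0 < g := by
    rw [hSfg] at hSpos
    exact pos_of_mul_pos_right hSpos hf.le
  have hMg : M = 12 * N ^ 3 * g ^ 2 := by
    rw [hM', hM2, hg2, hg, hN]; ring
  have hf3 : f ^ 2 = T + 12 * N ^ 3 * g ^ 2 := by rw [← hf2, eT, hMg]; ring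
  have hTe2 : T ^ 2 = 1 + 16 * N * (4 * N + 1) * g ^ 2 * (T + 12 * N ^ 3 * g ^ 2) := by
    rw [← hf3, hTe, hSfg]; ring
  have hTbig : 8 * N * (4 * N + 1) * g ^ 2 < T := by
    by_contra hcon
    push Not at hcon
    have h5 : T * T ≤ 8 * N * (4 * N + 1) * g ^ 2 * T := mul_le_mul_of_nonneg_right hcon (by omega)
    have h6 : 0 < 8 * N * (4 * N + 1) * g ^ 2 * T := by positivity
    have h7 : 0 < 16 * N * (4 * N + 1) * g ^ 2 * (12 * N ^ 3 * g ^ 2) := by positivity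
    nlinarith
  refine ⟨T - 8 * N * (4 * N + 1) * g ^ 2, g, by linarith, hgpos.ne', ?_, ?_, ?_⟩
  · exact ⟨t - (4 * N + 1) * g ^ 2, by rw [ht]; ring⟩
  · obtain ⟨q, hq | hq⟩ := hTc
    · exact ⟨q - 8 * N * g ^ 2, by rw [hq]; ring⟩
    · exfalso
      have : Y - T = 2 * M := by rw [eY, eT]; ring
      rw [hM', hM2, hu, hq] at this
      have e5 : 4 * N + 1 = 3 * (4 * e3 - 1) := by linarith
      rw [e5, he3] at this
      have : 3 * (4 * M2 - 8 * N * e3 * u ^ 2 + (4 * e3 - 1) * q) = 2 := by linarith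
      omega
  · linear_combination hTe2 - 64 * N ^ 2 * (4 * N + 1) * (N + 1) * g ^ 4 * hz

lemma cop4 {p q w : ℤ} (h : IsCoprime p q) (he : p * q = w ^ 4) (hp : 0 < p) (hq : 0 ≤ q) :
    ∃ a b : ℤ, 0 < a ∧ 0 ≤ b ∧ p = a ^ 4 ∧ q = b ^ 4 := by
  have four : ∀ {p q : ℤ}, IsCoprime p q → p * q = w ^ 4 → 0 < p → 0 < q →
      ∃ a : ℤ, 0 < a ∧ p = a ^ 4 := by
    intro p q h he hp hq
    obtain ⟨s, hs, hs2⟩ := sq_of_coprime_pos (c := w ^ 2) h (by rw [he]; ring) hp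
    obtain ⟨t, ht, ht2⟩ := sq_of_coprime_pos (c := w ^ 2) h.symm (by rw [mul_comm, he]; ring) hq
    have hst : s * t = w ^ 2 := by
      have : (s * t) ^ 2 = (w ^ 2) ^ 2 := by rw [mul_pow, ← hs2, ← ht2, he]; ring
      exact (pow_left_inj₀ (by positivity) (by positivity) (by norm_num)).1 this
    have hc : IsCoprime s t := by
      rw [hs2, ht2] at h
      exact (IsCoprime.pow_iff (by norm_num) (by norm_num)).1 h
    obtain ⟨a, ha, ha2⟩ := sq_of_coprime_pos hc hst hs
    exact ⟨a, ha, by rw [hs2, ha2]; ring⟩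
  rcases hq.eq_or_lt with hq | hq
  · subst hq
    have := isCoprime_zero_right.1 h
    rw [Int.isUnit_iff] at this
    exact ⟨1, 0, by norm_num, le_rfl, by omega, by norm_num⟩
  · obtain ⟨a, ha, ha2⟩ := four h he hp hq
    obtain ⟨b, hb, hb2⟩ := four h.symm (by rw [mul_comm, he]) hq hp
    exact ⟨a, b, ha, hb.le, ha2, hb2⟩

lemma split_prime {π p q y : ℤ} (e : ℕ) (hπ : Prime π) (h : IsCoprime p q) (he : p * q = π ^ e * y) :
    π ^ e ∣ p ∨ π ^ e ∣ q := by
  by_cases h1 : π ∣ p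
  · left
    have h2 : ¬ π ∣ q := fun h2 => hπ.not_isUnit (h.isUnit_of_dvd' h1 h2)
    have h3 : IsCoprime (π ^ e) q := ((hπ.irreducible.coprime_iff_not_dvd).2 h2).pow_left
    exact h3.dvd_of_dvd_mul_right ⟨y, he⟩
  · right
    have h3 : IsCoprime (π ^ e) p := ((hπ.irreducible.coprime_iff_not_dvd).2 h1).pow_left
    exact h3.dvd_of_dvd_mul_left ⟨y, he⟩

lemma cop_of {π p : ℤ} (hπ : Prime π) (h : ¬ π ∣ p) : IsCoprime p π :=
  ((hπ.irreducible.coprime_iff_not_dvd).2 h).symm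

lemma p11 : Prime (11 : ℤ) := Int.prime_iff_natAbs_prime.2 (by norm_num)
lemma p5 : Prime (5 : ℤ) := Int.prime_iff_natAbs_prime.2 (by norm_num)
lemma p89 : Prime (89 : ℤ) := Int.prime_iff_natAbs_prime.2 (by norm_num)
lemma p97 : Prime (97 : ℤ) := Int.prime_iff_natAbs_prime.2 (by norm_num)

/-- `e = 1` or `e = 4`. -/
lemma step_common {p B w e : ℤ} (he : e = 1 ∨ e = 4) (hp : 0 < p) (h2 : ¬ (2 : ℤ) ∣ p)
    (h3 : ¬ (3 : ℤ) ∣ p) (h11 : ¬ (11 : ℤ) ∣ p) (h : p * (p - 1) = 297 * B * e * w ^ 4) :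
    ∃ q, IsCoprime p q ∧ 0 ≤ q ∧ p - 1 = 297 * e * q ∧ p * q = B * w ^ 4 := by
  have c0 : IsCoprime p (p - 1) := ⟨1, -1, by ring⟩
  have c3 := cop_of Int.prime_three h3
  have c2 := cop_of Int.prime_two h2
  have c11 := cop_of p11 h11
  have ce : IsCoprime p e := by
    rcases he with rfl | rfl
    · exact isCoprime_one_right
    · have := c2.mul_right c2; norm_num at this; exact this
  have c297 : IsCoprime p (297 * e) := by
    have : (297 : ℤ) = 3 ^ 3 * 11 := by norm_num
    rw [this]
    exact (c3.pow_right.mul_right c11).mul_right ce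
  obtain ⟨q, hq⟩ : 297 * e ∣ p - 1 := c297.symm.dvd_of_dvd_mul_left ⟨B * w ^ 4, by rw [h]; ring⟩
  have hepos : 0 < e := by rcases he with rfl | rfl <;> norm_num
  refine ⟨q, ?_, ?_, hq, ?_⟩
  · rw [hq] at c0; exact c0.of_mul_right_right
  · by_contra hcon
    push Not at hcon
    have : e * q < 0 := mul_neg_of_pos_of_neg hepos hcon
    linarith
  · rw [hq] at h
    have : 297 * e * (p * q) = 297 * e * (B * w ^ 4) := by linarith
    exact mul_left_cancel₀ (by positivity) this

lemma step1 {p w e : ℤ} (he : e = 1 ∨ e = 4) (hp : 0 < p) (h2 : ¬ (2 : ℤ) ∣ p)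
    (h3 : ¬ (3 : ℤ) ∣ p) (h11 : ¬ (11 : ℤ) ∣ p) (h : p * (p - 1) = 7425 * e * w ^ 4) :
    ∃ a b, 0 < a ∧ p = a ^ 4 ∧ p - 1 = 7425 * e * b ^ 4 := by
  obtain ⟨q, c, hq0, hq, hpq⟩ := step_common (B := 25) (w := w) he hp h2 h3 h11 (by rw [h]; ring)
  rcases split_prime (π := 5) (y := w ^ 4) 2 p5 c (by rw [hpq]; norm_num) with ⟨p', h5⟩ | ⟨q', h5⟩
  · exfalso
    rw [h5] at c
    have e1 : p' * q = w ^ 4 := by rw [h5] at hpq; linarith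
    obtain ⟨a, b, ha, hb, h7, h8⟩ := cop4 c.of_mul_left_right e1 (by linarith) hq0
    rw [h5, h7, h8] at hq
    rw [h5, h7] at h2
    have a2 : ¬ (2 : ℤ) ∣ a := fun hh => h2 ((dvd_pow hh (by norm_num)).mul_left _)
    obtain ⟨r, hr⟩ : ∃ r, a = 2 * r + 1 := ⟨a / 2, by omega⟩
    rw [hr] at hq
    have h9 := congrArg (Int.cast : ℤ → ZMod 16) hq
    have k1 : ∀ r b : ZMod 16, (5 ^ 2 * (2 * r + 1) ^ 4 - 1 : ZMod 16) ≠ 297 * 1 * b ^ 4 := by decide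
    have k2 : ∀ r b : ZMod 16, (5 ^ 2 * (2 * r + 1) ^ 4 - 1 : ZMod 16) ≠ 297 * 4 * b ^ 4 := by decide
    rcases he with rfl | rfl
    · push_cast at h9; exact k1 _ _ h9
    · push_cast at h9; exact k2 _ _ h9
  · rw [h5] at c
    have e1 : p * q' = w ^ 4 := by rw [h5] at hpq; linarith
    obtain ⟨a, b, ha, hb, h7, h8⟩ := cop4 c.of_mul_right_right e1 hp (by linarith)
    refine ⟨a, b, ha, h7, ?_⟩
    rw [hq, h5, h8]; ring

lemma step10 {p w e : ℤ} (he : e = 1 ∨ e = 4) (hp : 0 < p) (h2 : ¬ (2 : ℤ) ∣ p)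
    (h3 : ¬ (3 : ℤ) ∣ p) (h11 : ¬ (11 : ℤ) ∣ p) (h : p * (p - 1) = 2564001 * e * w ^ 4) :
    ∃ a b, 0 < a ∧ p = a ^ 4 ∧ p - 1 = 2564001 * e * b ^ 4 := by
  obtain ⟨q, c, hq0, hq, hpq⟩ := step_common (B := 8633) (w := w) he hp h2 h3 h11 (by rw [h]; ring)
  rcases split_prime (π := 89) (y := 97 * w ^ 4) 1 p89 c (by rw [hpq]; ring) with ⟨p', h5⟩ | ⟨q', h5⟩
  · exfalso
    rw [pow_one] at h5
    have c' := c
    rw [h5] at c'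
    have e1 : p' * q = 97 * w ^ 4 := by rw [h5] at hpq; linarith
    have k1 : ∀ e r b : ZMod 3, (89 * r ^ 4 - 1 : ZMod 3) ≠ 297 * e * b := by decide
    have k2 : ∀ e r b : ZMod 3, (89 * (97 * r ^ 4) - 1 : ZMod 3) ≠ 297 * e * b := by decide
    rcases split_prime (π := 97) (y := w ^ 4) 1 p97 c'.of_mul_left_right (by rw [e1]; ring) with ⟨p2, h6⟩ | ⟨q2, h6⟩
    · rw [pow_one] at h6
      have c2 := c'.of_mul_left_right
      rw [h6] at c2
      obtain ⟨a, b, ha, hb, h7, h8⟩ := cop4 (w := w) c2.of_mul_left_right (by rw [h6] at e1; linarith)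
        (by linarith) hq0
      rw [h5, h6, h7] at hq
      have h9 := congrArg (Int.cast : ℤ → ZMod 3) hq
      push_cast at h9
      exact k2 _ _ _ h9
    · rw [pow_one] at h6
      have c2 := c'.of_mul_left_right
      rw [h6] at c2
      obtain ⟨a, b, ha, hb, h7, h8⟩ := cop4 (w := w) c2.of_mul_right_right (by rw [h6] at e1; linarith)
        (by linarith) (by linarith)
      rw [h5, h7] at hq
      have h9 := congrArg (Int.cast : ℤ → ZMod 3) hq
      push_cast at h9
      exact k1 _ _ _ h9
  · rw [pow_one] at h5
    have c' := c
    rw [h5] at c'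
    have e1 : p * q' = 97 * w ^ 4 := by rw [h5] at hpq; linarith
    rcases split_prime (π := 97) (y := w ^ 4) 1 p97 c'.of_mul_right_right (by rw [e1]; ring) with ⟨p2, h6⟩ | ⟨q2, h6⟩
    · exfalso
      rw [pow_one] at h6
      have c2 := c'.of_mul_right_right
      rw [h6] at c2
      obtain ⟨a, b, ha, hb, h7, h8⟩ := cop4 (w := w) c2.of_mul_left_right (by rw [h6] at e1; linarith)
        (by linarith) (by linarith)
      rw [h6, h7, h5, h8] at hq
      have h9 := congrArg (Int.cast : ℤ → ZMod 5) hq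
      have k1 : ∀ r b : ZMod 5, (97 * r ^ 4 - 1 : ZMod 5) ≠ 297 * 1 * (89 * b ^ 4) := by decide
      have k2 : ∀ r b : ZMod 5, (97 * r ^ 4 - 1 : ZMod 5) ≠ 297 * 4 * (89 * b ^ 4) := by decide
      rcases he with rfl | rfl
      · push_cast at h9; exact k1 _ _ h9
      · push_cast at h9; exact k2 _ _ h9
    · rw [pow_one] at h6
      have c2 := c'.of_mul_right_right
      rw [h6] at c2
      obtain ⟨a, b, ha, hb, h7, h8⟩ := cop4 (w := w) c2.of_mul_right_right (by rw [h6] at e1; linarith)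
        hp (by linarith)
      refine ⟨a, b, ha, h7, ?_⟩
      rw [hq, h5, h6, h8]; ring

/-- Descent for `r⁴ - 1 = F e v⁴`, `e ∈ {1, 4}`, given a step lemma. -/
lemma quartic_descent (F : ℤ) (hF : ∃ f, F = 1 + 16 * f)
    (step : ∀ p w e : ℤ, (e = 1 ∨ e = 4) → 0 < p → ¬ (2 : ℤ) ∣ p → ¬ (3 : ℤ) ∣ p → ¬ (11 : ℤ) ∣ p →
      p * (p - 1) = F * e * w ^ 4 → ∃ a b, 0 < a ∧ p = a ^ 4 ∧ p - 1 = F * e * b ^ 4) :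
    ∀ (n : ℕ) (r v e : ℤ), (e = 1 ∨ e = 4) → 0 < r → r ≤ n → r ^ 4 - 1 = F * e * v ^ 4 → r = 1 := by
  intro n
  obtain ⟨f, hf⟩ := hF
  induction n with
  | zero => intro r v e he h1 h2; push_cast at h2; omega
  | succ n ih =>
    intro r v e he h1 h2 h
    by_contra hr1
    have hr2 : 2 ≤ r := by omega
    have hodd : ∃ s, r = 2 * s + 1 := by
      rcases Int.even_or_odd' r with ⟨s, hs | hs⟩
      · exfalso
        rw [hs, hf] at h
        have h9 := congrArg (Int.cast : ℤ → ZMod 16) h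
        have k1 : ∀ r b f : ZMod 16, ((2 * r) ^ 4 - 1 : ZMod 16) ≠ (1 + 16 * f) * 1 * b ^ 4 := by decide
        have k2 : ∀ r b f : ZMod 16, ((2 * r) ^ 4 - 1 : ZMod 16) ≠ (1 + 16 * f) * 4 * b ^ 4 := by decide
        rcases he with rfl | rfl
        · push_cast at h9; exact k1 _ _ _ h9
        · push_cast at h9; exact k2 _ _ _ h9
      · exact ⟨s, hs⟩
    obtain ⟨s, hs⟩ := hodd
    set p := 2 * s ^ 2 + 2 * s + 1 with hp
    have hrp : r ^ 2 = 2 * p - 1 := by rw [hs, hp]; ring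
    have hppos : 0 < p := by nlinarith
    have n2 : ¬ (2 : ℤ) ∣ p := by
      rintro ⟨y, hy⟩
      have : 2 * (s ^ 2 + s - y) = -1 := by linarith
      omega
    have n3 : ¬ (3 : ℤ) ∣ p := by
      rintro ⟨y, hy⟩
      rw [hy] at hrp
      have h9 := congrArg (Int.cast : ℤ → ZMod 3) hrp
      have k1 : ∀ r y : ZMod 3, (r ^ 2 : ZMod 3) ≠ 2 * (3 * y) - 1 := by decide
      push_cast at h9; exact k1 _ _ h9
    have n11 : ¬ (11 : ℤ) ∣ p := by
      rintro ⟨y, hy⟩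
      rw [hy] at hrp
      have h9 := congrArg (Int.cast : ℤ → ZMod 11) hrp
      have k1 : ∀ r y : ZMod 11, (r ^ 2 : ZMod 11) ≠ 2 * (11 * y) - 1 := by decide
      push_cast at h9; exact k1 _ _ h9
    have hpp : 4 * (p * (p - 1)) = F * e * v ^ 4 := by
      rw [← h]
      have : r ^ 4 = (2 * p - 1) ^ 2 := by rw [← hrp]; ring
      rw [this]; ring
    obtain ⟨e', w, he', hw⟩ : ∃ e' w, (e' = 1 ∨ e' = 4) ∧ p * (p - 1) = F * e' * w ^ 4 := by
      rcases he with rfl | rfl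
      · have hv : (2 : ℤ) ∣ v := by
          apply Int.prime_two.dvd_of_dvd_pow (n := 4)
          refine ⟨2 * (p * (p - 1)) - 8 * f * v ^ 4, ?_⟩
          rw [hf] at hpp; linarith
        obtain ⟨w, rfl⟩ := hv
        exact ⟨4, w, Or.inr rfl, by linarith⟩
      · exact ⟨1, v, Or.inl rfl, by linarith⟩
    obtain ⟨a, b, ha, hpa, hpb⟩ := step p w e' he' hppos n2 n3 n11 hw
    have har : a < r := by
      have h1 : a ^ 4 < r ^ 2 := by
        have : 2 ≤ p := by nlinarith
        rw [← hpa]; linarith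
      have h2 : a ^ 2 < r := lt_of_pow_lt_pow_left₀ 2 (by omega) (by rw [← pow_mul]; exact h1)
      nlinarith
    have ha1 := ih a b e' he' ha (by push_cast at h2; omega) (by rw [← hpa, hpb])
    rw [ha1] at hpa
    nlinarith

set_option maxHeartbeats 1000000 in
lemma five_b_final (k z0 : ℤ) (hk : 0 < k) (hk99 : k < 99) (n m : ℕ) (hz : z0 ^ 2 = 3 * (8 * k ^ 2) + 1)
    (hm : 1 ≤ m)
    (h : pu (2 * (8 * k ^ 2) + 1) (2 * n) = 2 * z0 * pu (8 * (8 * k ^ 2) + 1) m) : False := by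
  rcases small_k k z0 hk (by rw [hz]; ring) hk99 with rfl | rfl
  · obtain ⟨X, g, hX, hg, ⟨x1, h1⟩, ⟨x2, h2⟩, h3⟩ := five_b 1 z0 hk n m hz hm (by norm_num) h
    rw [hz] at h3
    norm_num at h1 h2 h3
    obtain ⟨p, hp⟩ : ∃ p, X = 2 * p - 1 := ⟨32 * x1 + 1, by linarith⟩
    have hpp : p * (p - 1) = 7425 * 4 * (4 * g) ^ 4 := by rw [hp] at h3; linarith
    obtain ⟨a, b, ha, hpa, hpb⟩ := step1 (Or.inr rfl) (by omega) (by omega) (by omega) (by omega) hpp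
    have ha1 := quartic_descent 7425 ⟨464, by norm_num⟩ (fun p w e h1 h2 h3 h4 h5 h6 => step1 h1 h2 h3 h4 h5 h6)
      a.toNat a b 4 (Or.inr rfl) ha (Int.self_le_toNat _) (by rw [← hpa, hpb])
    rw [ha1] at hpa
    rw [hpa] at hpp
    have : 0 < g ^ 4 := by positivity
    linarith
  · obtain ⟨X, g, hX, hg, ⟨x1, h1⟩, ⟨x2, h2⟩, h3⟩ := five_b 10 z0 hk n m hz hm (by norm_num) h
    rw [hz] at h3
    norm_num at h1 h2 h3
    obtain ⟨p, hp⟩ : ∃ p, X = 2 * p - 1 := ⟨3200 * x1 + 1, by linarith⟩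
    have hq : 0 < p ∧ ¬ (2 : ℤ) ∣ p ∧ ¬ (3 : ℤ) ∣ p ∧ ¬ (11 : ℤ) ∣ p := by
      clear h3 hz h; omega
    have hpp : p * (p - 1) = 2564001 * 4 * (280 * g) ^ 4 := by rw [hp] at h3; linarith
    obtain ⟨a, b, ha, hpa, hpb⟩ := step10 (Or.inr rfl) hq.1 hq.2.1 hq.2.2.1 hq.2.2.2 hpp
    have ha1 := quartic_descent 2564001 ⟨160250, by norm_num⟩ (fun p w e h1 h2 h3 h4 h5 h6 => step10 h1 h2 h3 h4 h5 h6)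
      a.toNat a b 4 (Or.inr rfl) ha (Int.self_le_toNat _) (by rw [← hpa, hpb])
    rw [ha1] at hpa
    rw [hpa] at hpp
    have : 0 < g ^ 4 := by positivity
    linarith

section
open PowerSeries

/-- the nodes `0, 1, 4` -/
noncomputable def nd : Fin 3 → ℝ := ![0, 1, 4]

noncomputable def Zs (j : Fin 3) : PowerSeries ℝ := C (nd j) + X

noncomputable def iv (j l : Fin 3) : PowerSeries ℝ := (C (nd j - nd l) + X)⁻¹

noncomputable def lam (κ : Fin 3 → ℕ) (H : ℕ) : ℝ :=
  ∑ j, coeff (κ j) (X * (Zs j ^ H * ∏ l ∈ Finset.univ.erase j, iv j l ^ κ l))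

lemma nd_inj : Function.Injective nd := by
  intro i j h
  fin_cases i <;> fin_cases j <;> simp [nd] at h ⊢

lemma nd_bd (j : Fin 3) : 0 ≤ nd j ∧ nd j ≤ 4 := by
  fin_cases j <;> simp [nd]

lemma iv_mul {j l : Fin 3} (h : j ≠ l) : (C (nd j - nd l) + X) * iv j l = 1 := by
  apply PowerSeries.mul_inv_cancel
  simp only [map_add, constantCoeff_C, constantCoeff_X, add_zero]
  rw [sub_ne_zero]
  exact fun h2 => h (nd_inj h2)

def bump (κ : Fin 3 → ℕ) (i : Fin 3) : Fin 3 → ℕ := fun j => if j = i then κ j + 1 else κ j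

@[simp] lemma bump_self (κ : Fin 3 → ℕ) (i : Fin 3) : bump κ i i = κ i + 1 := by simp [bump]

lemma bump_ne (κ : Fin 3 → ℕ) {i j : Fin 3} (h : j ≠ i) : bump κ i j = κ j := by simp [bump, h]

lemma bump_sum (κ : Fin 3 → ℕ) (i : Fin 3) : ∑ j, bump κ i j = ∑ j, κ j + 1 := by
  fin_cases i <;> simp [bump, Fin.sum_univ_three] <;> omega

lemma bump_comm (κ : Fin 3 → ℕ) (i j : Fin 3) : bump (bump κ i) j = bump (bump κ j) i := by
  ext l; simp only [bump]; split_ifs <;> rfl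

lemma exists_bump (κ : Fin 3 → ℕ) (i : Fin 3) (h : κ i ≠ 0) : ∃ κ', κ = bump κ' i := by
  refine ⟨fun j => if j = i then κ j - 1 else κ j, ?_⟩
  ext j
  simp only [bump]
  split_ifs with hj
  · subst hj; omega
  · rfl

lemma lam_succ (κ : Fin 3 → ℕ) (i : Fin 3) (H : ℕ) :
    lam (bump κ i) (H + 1) = nd i * lam (bump κ i) H + lam κ H := by
  unfold lam
  rw [Finset.mul_sum, ← Finset.sum_add_distrib]
  apply Finset.sum_congr rfl
  intro j _
  by_cases hij : j = i
  · subst hij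
    have hprod : ∏ l ∈ Finset.univ.erase j, iv j l ^ (bump κ j) l =
        ∏ l ∈ Finset.univ.erase j, iv j l ^ κ l := by
      apply Finset.prod_congr rfl
      intro l hl
      have : l ≠ j := Finset.ne_of_mem_erase hl
      rw [bump_ne _ this]
    rw [hprod]
    set F := ∏ l ∈ Finset.univ.erase j, iv j l ^ κ l
    have e : X * (Zs j ^ (H + 1) * F) = C (nd j) * (X * (Zs j ^ H * F)) + X * (X * (Zs j ^ H * F)) := by
      rw [pow_succ, Zs]; ring
    rw [e, map_add, coeff_C_mul]
    congr 1
    have : (bump κ j) j = κ j + 1 := by simp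
    rw [this, coeff_succ_X_mul]
  · have hκ : (bump κ i) j = κ j := bump_ne _ hij
    have hmem : i ∈ Finset.univ.erase j := by simp [Ne.symm hij]
    have hprod : ∏ l ∈ Finset.univ.erase j, iv j l ^ κ l =
        (C (nd j - nd i) + X) * ∏ l ∈ Finset.univ.erase j, iv j l ^ (bump κ i) l := by
      rw [← Finset.mul_prod_erase _ _ hmem, ← Finset.mul_prod_erase _ _ hmem]
      have e1 : ∏ l ∈ (Finset.univ.erase j).erase i, iv j l ^ (bump κ i) l =
          ∏ l ∈ (Finset.univ.erase j).erase i, iv j l ^ κ l := by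
        apply Finset.prod_congr rfl
        intro l hl
        have : l ≠ i := Finset.ne_of_mem_erase hl
        rw [bump_ne _ this]
      rw [e1]
      have : (bump κ i) i = κ i + 1 := by simp
      rw [this, pow_succ]
      linear_combination (-(iv j i ^ κ i * ∏ l ∈ (Finset.univ.erase j).erase i, iv j l ^ κ l)) * iv_mul hij
    rw [hprod, hκ]
    set F := ∏ l ∈ Finset.univ.erase j, iv j l ^ (bump κ i) l
    rw [← coeff_C_mul, ← map_add]
    congr 1
    rw [pow_succ, Zs, map_sub]; ring

lemma lam_zero_zero (κ : Fin 3 → ℕ) (hκ : κ = 0) (H : ℕ) : lam κ H = 0 := by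
  subst hκ
  simp [lam]

lemma lam_zero (K : ℕ) : ∀ κ : Fin 3 → ℕ, ∑ j, κ j = K → lam κ 0 = if K = 1 then 1 else 0 := by
  induction K with
  | zero =>
    intro κ h
    rw [lam_zero_zero κ (by ext j; simpa using (Finset.sum_eq_zero_iff.1 h) j (Finset.mem_univ _))]
    simp
  | succ K ih =>
    intro κ h
    obtain ⟨i, hi⟩ : ∃ i, κ i ≠ 0 := by
      by_contra hcon
      push Not at hcon
      simp [hcon] at h
    obtain ⟨κ', rfl⟩ := exists_bump κ i hi
    by_cases hex : ∃ j, j ≠ i ∧ κ' j ≠ 0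
    · obtain ⟨j, hji, hj⟩ := hex
      obtain ⟨κ2, rfl⟩ := exists_bump κ' j hj
      have h1 := lam_succ (bump κ2 j) i 0
      have h2 := lam_succ (bump κ2 i) j 0
      have e : bump (bump κ2 i) j = bump (bump κ2 j) i := by
        rw [bump_comm]
      rw [e] at h2
      have hs : ∑ l, (bump κ2 j ) l = K := by
        rw [bump_sum, bump_sum] at h
        rw [bump_sum]
        omega
      have hs2 : ∑ l, (bump κ2 i ) l = K := by
        rw [bump_sum, bump_sum] at h
        rw [bump_sum]
        omega
      rw [ih _ hs] at h1
      rw [ih _ hs2] at h2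
      have h3 : (nd i - nd j) * lam (bump (bump κ2 j) i) 0 = 0 := by linarith
      have hne : nd i - nd j ≠ 0 := by
        rw [sub_ne_zero]; exact fun h2 => hji (nd_inj h2).symm
      rw [(mul_eq_zero.1 h3).resolve_left hne]
      have hK : K ≠ 0 := by
        rw [← hs]
        rw [bump_sum]; omega
      simp [hK]
    · push Not at hex
      have hK : κ' i = K := by
        have : ∑ l, κ' l = κ' i := by
          apply Finset.sum_eq_single i
          · intro b _ hb; exact hex b hb
          · simp
        rw [bump_sum] at h
        omega
      unfold lam
      rw [Finset.sum_eq_single i]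
      · have hprod : ∏ l ∈ Finset.univ.erase i, iv i l ^ (bump κ' i) l = 1 := by
          apply Finset.prod_eq_one
          intro l hl
          have : l ≠ i := Finset.ne_of_mem_erase hl
          rw [bump_ne _ this, hex l this, pow_zero]
        rw [hprod]
        have : (bump κ' i) i = K + 1 := by simp [hK]
        rw [this, coeff_succ_X_mul]
        simp [coeff_one]
      · intro j _ hj
        have : (bump κ' i) j = 0 := by rw [bump_ne _ hj, hex j hj]
        rw [this]
        simp
      · simp

lemma lam_bound (H : ℕ) : ∀ (K : ℕ) (κ : Fin 3 → ℕ), ∑ j, κ j = K + 1 →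
    0 ≤ lam κ H ∧ lam κ H * 4 ^ K ≤ H.choose K * 4 ^ H := by
  induction H with
  | zero =>
    intro K κ h
    rw [lam_zero _ κ h]
    rcases K with _ | K <;> simp
  | succ H ih =>
    intro K κ h
    obtain ⟨i, hi⟩ : ∃ i, κ i ≠ 0 := by
      by_contra hcon
      push Not at hcon
      simp [hcon] at h
    obtain ⟨κ', rfl⟩ := exists_bump κ i hi
    have hs : ∑ l, κ' l = K := by
      rw [bump_sum] at h
      omega
    rw [lam_succ]
    obtain ⟨h1, h2⟩ := ih K _ h
    have hb := nd_bd i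
    have h4 : nd i * lam (bump κ' i) H ≤ 4 * lam (bump κ' i) H :=
      mul_le_mul_of_nonneg_right hb.2 h1
    have h5 : 0 ≤ nd i * lam (bump κ' i) H := mul_nonneg hb.1 h1
    have h6 : nd i * lam (bump κ' i) H * 4 ^ K ≤ 4 * lam (bump κ' i) H * 4 ^ K :=
      mul_le_mul_of_nonneg_right h4 (by positivity)
    rcases K with _ | K
    · rw [lam_zero_zero κ' (by ext j; simpa using (Finset.sum_eq_zero_iff.1 hs) j (Finset.mem_univ _))]
      simp at h2 h6 ⊢
      rw [pow_succ]
      constructor <;> linarith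
    · obtain ⟨h7, h8⟩ := ih K κ' hs
      refine ⟨by linarith, ?_⟩
      rw [Nat.choose_succ_succ]
      push_cast
      have e1 : (4 : ℝ) ^ (K + 1) = 4 ^ K * 4 := pow_succ _ _
      have e2 : (4 : ℝ) ^ (H + 1) = 4 ^ H * 4 := pow_succ _ _
      rw [e1] at h2 h6 ⊢
      rw [e2]
      nlinarith

noncomputable def bb (n h : ℕ) : ℝ := Ring.choose ((n : ℝ) - 1 / 2) h

lemma rc_succ (r : ℝ) (h : ℕ) : Ring.choose r (h + 1) * (h + 1) = Ring.choose r h * (r - h) := by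
  have := Ring.choose_smul_choose r (Nat.le_succ h)
  have e : h.succ - h = 1 := by omega
  rw [e, Ring.choose_one_right, Nat.succ_eq_add_one, Nat.choose_succ_self_right] at this
  rw [← this, nsmul_eq_mul]; push_cast; ring

lemma bb_zero (n : ℕ) : bb n 0 = 1 := by simp [bb]

lemma bb_succ (n h : ℕ) : bb n (h + 1) * (h + 1) = bb n h * (n - 1 / 2 - h) := rc_succ _ _

lemma bb_pascal (n h : ℕ) : bb (n + 1) (h + 1) = bb n h + bb n (h + 1) := by
  unfold bb
  rw [← Ring.choose_succ_succ]
  congr 1; push_cast; ring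

lemma bb_absorb (n h : ℕ) : bb (n + 1) (h + 1) * (h + 1) = bb n h * (n + 1 / 2) := by
  rw [bb_pascal, add_mul, bb_succ]; ring

lemma bb_int (n : ℕ) : ∀ h, ∃ z : ℤ, (z : ℝ) = 4 ^ h * bb n h := by
  induction n with
  | zero =>
    have key : ∀ h, 4 ^ h * bb 0 h = (-1) ^ h * (Nat.centralBinom h : ℝ) := by
      intro h
      induction h with
      | zero => simp [bb_zero]
      | succ h ih =>
        have h1 := bb_succ 0 h
        have h2 : ((h : ℝ) + 1) * (Nat.centralBinom (h + 1) : ℝ) = 2 * (2 * h + 1) * Nat.centralBinom h := by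
          exact_mod_cast Nat.succ_mul_centralBinom_succ h
        have h3 : ((h : ℝ) + 1) ≠ 0 := by positivity
        apply mul_right_cancel₀ h3
        have e1 : 4 ^ (h + 1) * bb 0 (h + 1) * ((h : ℝ) + 1) = 4 ^ h * bb 0 h * (4 * (((0 : ℕ) : ℝ) - 1 / 2 - h)) := by
          rw [mul_assoc, h1]; ring
        rw [e1, ih, mul_assoc ((-1) ^ (h + 1)), mul_comm (Nat.centralBinom (h + 1) : ℝ), h2]
        push_cast
        ring
    intro h
    refine ⟨(-1) ^ h * Nat.centralBinom h, ?_⟩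
    rw [key]; push_cast; rfl
  | succ n ih =>
    intro h
    rcases h with _ | h
    · exact ⟨1, by simp [bb_zero]⟩
    · obtain ⟨a, ha⟩ := ih h
      obtain ⟨b, hb⟩ := ih (h + 1)
      refine ⟨4 * a + b, ?_⟩
      rw [bb_pascal]; push_cast; rw [ha, hb]; ring

lemma bb_abs_zero (h : ℕ) : |bb 0 h| ≤ 1 := by
  induction h with
  | zero => simp [bb_zero]
  | succ h ih =>
    have h1 := bb_succ 0 h
    have h2 := congrArg abs h1
    rw [abs_mul, abs_mul, abs_of_pos (by positivity : (0 : ℝ) < h + 1)] at h2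
    have h3 : |((0 : ℕ) : ℝ) - 1 / 2 - h| ≤ h + 1 := by
      rw [abs_le]; push_cast; constructor <;> linarith [Nat.cast_nonneg (α := ℝ) h]
    have h4 : |bb 0 (h + 1)| * (h + 1) ≤ 1 * (h + 1) := by
      rw [h2]
      exact mul_le_mul ih h3 (abs_nonneg _) (by norm_num)
    exact le_of_mul_le_mul_right h4 (by positivity)

lemma bb_abs (n : ℕ) : ∀ h, |bb n h| ≤ 2 ^ n := by
  induction n with
  | zero => intro h; simpa using bb_abs_zero h
  | succ n ih =>
    intro h
    rcases h with _ | h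
    · rw [bb_zero, abs_one]; exact one_le_pow₀ (by norm_num)
    · rw [bb_pascal]
      refine (abs_add_le _ _).trans ?_
      have := ih h
      have := ih (h + 1)
      rw [pow_succ]; linarith

lemma bb_abs_one (n : ℕ) : ∀ h, n ≤ h → |bb n h| ≤ 1 := by
  induction n with
  | zero => intro h _; exact bb_abs_zero h
  | succ n ih =>
    intro h hn
    rcases h with _ | h
    · omega
    · have h2 := congrArg abs (bb_absorb n h)
      rw [abs_mul, abs_mul, abs_of_pos (by positivity : (0 : ℝ) < h + 1),
        abs_of_pos (by positivity : (0 : ℝ) < n + 1 / 2)] at h2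
      have h3 : (n : ℝ) ≤ h := by exact_mod_cast (by omega : n ≤ h)
      have h4 : |bb (n + 1) (h + 1)| * (h + 1) ≤ 1 * (h + 1) := by
        rw [h2]
        exact mul_le_mul (ih h (by omega)) (by linarith) (by positivity) (by norm_num)
      exact le_of_mul_le_mul_right h4 (by positivity)

lemma binser (r u : ℝ) (hu : |u| < 1) : HasSum (fun i => Ring.choose r i * u ^ i) ((1 + u) ^ r) := by
  have h := (Real.one_add_rpow_hasFPowerSeriesOnBall_zero (a := r)).hasSum (y := u)
    (by simpa [Metric.mem_eball, edist_dist, Real.dist_eq] using hu)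
  simpa only [zero_add, binomialSeries_apply, List.ofFn_const, List.prod_replicate, smul_eq_mul] using h

lemma coeff_Zs_pow (j : Fin 3) (h s : ℕ) : coeff s (Zs j ^ h) = nd j ^ (h - s) * (h.choose s : ℝ) := by
  rw [← Polynomial.coeff_X_add_C_pow, ← Polynomial.coeff_coe]
  congr 1
  simp [Zs, add_comm]

/-- summation of the shifted binomial series -/
lemma binser_shift (ν s : ℕ) (j : Fin 3) (x : ℝ) (hx : 0 < x) (hx4 : 4 * x < 1) (hs : s ≤ ν) :
    HasSum (fun h => bb (ν + 1) h * x ^ h * coeff s (Zs j ^ h))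
      (Real.sqrt (1 + nd j * x) * (bb (ν + 1) s * (1 + nd j * x) ^ ν * (x / (1 + nd j * x)) ^ s)) := by
  have hb := nd_bd j
  have hu0 : 0 ≤ nd j * x := mul_nonneg hb.1 hx.le
  have hu1 : nd j * x < 1 := lt_of_le_of_lt (mul_le_mul_of_nonneg_right hb.2 hx.le) hx4
  have hy : 0 < 1 + nd j * x := by linarith
  have h1 := (binser (((ν + 1 : ℕ) : ℝ) - 1 / 2 - s) (nd j * x) (by rw [abs_of_nonneg hu0]; exact hu1)).mul_left
    (bb (ν + 1) s * x ^ s)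
  rw [← hasSum_nat_add_iff' s]
  have hz : ∑ i ∈ Finset.range s, bb (ν + 1) i * x ^ i * coeff s (Zs j ^ i) = 0 := by
    apply Finset.sum_eq_zero
    intro i hi
    rw [coeff_Zs_pow, Nat.choose_eq_zero_of_lt (Finset.mem_range.1 hi)]; simp
  rw [hz, sub_zero]
  have k1 : (fun i => bb (ν + 1) (i + s) * x ^ (i + s) * coeff s (Zs j ^ (i + s))) =
      fun i => bb (ν + 1) s * x ^ s * (Ring.choose (((ν + 1 : ℕ) : ℝ) - 1 / 2 - s) i * (nd j * x) ^ i) := by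
    funext i
    rw [coeff_Zs_pow, Nat.add_sub_cancel]
    have := Ring.choose_smul_choose (((ν + 1 : ℕ) : ℝ) - 1 / 2) (Nat.le_add_left s i)
    rw [Nat.add_sub_cancel, nsmul_eq_mul] at this
    unfold bb
    rw [pow_add, mul_pow]
    linear_combination (x ^ i * x ^ s * nd j ^ i) * this
  have k2 : Real.sqrt (1 + nd j * x) * (bb (ν + 1) s * (1 + nd j * x) ^ ν * (x / (1 + nd j * x)) ^ s) =
      bb (ν + 1) s * x ^ s * (1 + nd j * x) ^ (((ν + 1 : ℕ) : ℝ) - 1 / 2 - s) := by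
    have e : (((ν + 1 : ℕ) : ℝ) - 1 / 2 - s) = 1 / 2 + ((ν - s : ℕ) : ℝ) := by
      rw [Nat.cast_sub hs]; push_cast; ring
    rw [e, Real.rpow_add hy, Real.rpow_natCast, ← Real.sqrt_eq_rpow]
    have e2 : (1 + nd j * x) ^ ν = (1 + nd j * x) ^ (ν - s) * (1 + nd j * x) ^ s := by
      rw [← pow_add]; congr 1; omega
    rw [e2, div_pow]
    field_simp
  rw [k1, k2]
  exact h1

lemma nd0 : nd 0 = 0 := rfl
lemma nd1 : nd 1 = 1 := rfl
lemma nd2 : nd 2 = 4 := rfl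

noncomputable def gg (ν : ℕ) (x : ℝ) (j : Fin 3) : PowerSeries ℝ :=
  PowerSeries.mk fun h => bb (ν + 1) h * (1 + nd j * x) ^ ν * (x / (1 + nd j * x)) ^ h

noncomputable def II (j : Fin 3) : PowerSeries ℝ := ∏ l ∈ Finset.univ.erase j, iv j l

noncomputable def pt (ν : ℕ) (x : ℝ) (t : ℕ) (j : Fin 3) : ℝ :=
  coeff ν (Zs j ^ t * II j ^ (ν + 1) * gg ν x j)

/-- integrality predicate -/
def JJ (n : ℕ) (D : ℝ) (F : PowerSeries ℝ) : Prop :=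
  ∀ s, s < n → ∃ z : ℤ, (z : ℝ) = D * 12 ^ s * coeff s F

lemma int_sum {ι : Type*} (S : Finset ι) (f : ι → ℝ) (h : ∀ i ∈ S, ∃ z : ℤ, (z : ℝ) = f i) :
    ∃ z : ℤ, (z : ℝ) = ∑ i ∈ S, f i := by
  classical
  induction S using Finset.induction_on with
  | empty => exact ⟨0, by simp⟩
  | insert a S ha ih =>
    obtain ⟨u, hu⟩ := h a (Finset.mem_insert_self _ _)
    obtain ⟨w, hw⟩ := ih (fun i hi => h i (Finset.mem_insert_of_mem hi))
    exact ⟨u + w, by rw [Finset.sum_insert ha]; push_cast; rw [hu, hw]⟩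

lemma JJ_mul {n : ℕ} {D E : ℝ} {F G : PowerSeries ℝ} (hF : JJ n D F) (hG : JJ n E G) :
    JJ n (D * E) (F * G) := by
  intro s hs
  rw [coeff_mul, Finset.mul_sum]
  apply int_sum
  rintro ⟨i, l⟩ hil
  rw [Finset.HasAntidiagonal.mem_antidiagonal] at hil
  simp only at hil ⊢
  obtain ⟨u, hu⟩ := hF i (by omega)
  obtain ⟨w, hw⟩ := hG l (by omega)
  refine ⟨u * w, ?_⟩
  push_cast
  rw [hu, hw, ← hil, pow_add]; ring

lemma JJ_one (n : ℕ) : JJ n 1 1 := by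
  intro s _
  rw [coeff_one]
  split_ifs with h
  · exact ⟨1, by simp [h]⟩
  · exact ⟨0, by simp⟩

lemma JJ_pow {n : ℕ} {D : ℝ} {F : PowerSeries ℝ} (hF : JJ n D F) (m : ℕ) : JJ n (D ^ m) (F ^ m) := by
  induction m with
  | zero => simpa using JJ_one n
  | succ m ih => rw [pow_succ, pow_succ]; exact JJ_mul ih hF

lemma JJ_scale {n : ℕ} {D : ℝ} {F : PowerSeries ℝ} (hF : JJ n D F) (q : ℤ) : JJ n (q * D) F := by
  intro s hs
  obtain ⟨u, hu⟩ := hF s hs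
  exact ⟨q * u, by push_cast; rw [hu]; ring⟩

lemma iv_coeff_zero {j l : Fin 3} (h : j ≠ l) : (nd j - nd l) * coeff 0 (iv j l) = 1 := by
  have := congrArg (coeff 0) (iv_mul h)
  rw [add_mul, map_add, coeff_C_mul] at this
  simpa using this

lemma iv_coeff_succ {j l : Fin 3} (h : j ≠ l) (s : ℕ) :
    (nd j - nd l) * coeff (s + 1) (iv j l) = - coeff s (iv j l) := by
  have := congrArg (coeff (s + 1)) (iv_mul h)
  rw [add_mul, map_add, coeff_C_mul, coeff_succ_X_mul, coeff_one] at this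
  simp at this
  linarith

lemma JJ_iv {j l : Fin 3} (h : j ≠ l) (n : ℕ) (q : ℤ) (hq : q * (nd j - nd l) = 12) :
    JJ n (nd j - nd l) (iv j l) := by
  intro s _
  induction s with
  | zero => exact ⟨1, by rw [pow_zero, mul_one, iv_coeff_zero h]; simp⟩
  | succ s ih =>
    obtain ⟨z, hz⟩ := ih (by omega)
    refine ⟨-q * z, ?_⟩
    push_cast
    rw [hz, pow_succ]
    have := iv_coeff_succ h s
    linear_combination (12 ^ s * 12) * (-this) - 12 ^ s * coeff s (iv j l) * hq

lemma JJ_II (n : ℕ) (j : Fin 3) : JJ n 12 (II j) := by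
  unfold II
  fin_cases j
  · have e : (Finset.univ.erase (0 : Fin 3)) = {1, 2} := by decide
    simp only [Fin.zero_eta, e]
    rw [Finset.prod_pair (by decide)]
    have h := JJ_scale (JJ_mul (JJ_iv (j := 0) (l := 1) (by decide) n (-12) (by simp [nd]))
      (JJ_iv (j := 0) (l := 2) (by decide) n (-3) (by norm_num [nd0, nd1, nd2]))) 3
    convert h using 1
    norm_num [nd0, nd1, nd2]
  · have e : (Finset.univ.erase (1 : Fin 3)) = {0, 2} := by decide
    simp only [Fin.mk_one, e]
    rw [Finset.prod_pair (by decide)]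
    have h := JJ_scale (JJ_mul (JJ_iv (j := 1) (l := 0) (by decide) n (12) (by simp [nd]))
      (JJ_iv (j := 1) (l := 2) (by decide) n (-4) (by norm_num [nd0, nd1, nd2]))) (-4)
    convert h using 1
    norm_num [nd0, nd1, nd2]
  · have e : (Finset.univ.erase (2 : Fin 3)) = {0, 1} := by decide
    simp only [Fin.reduceFinMk, e]
    rw [Finset.prod_pair (by decide)]
    have h := JJ_scale (JJ_mul (JJ_iv (j := 2) (l := 0) (by decide) n (3) (by norm_num [nd0, nd1, nd2]))
      (JJ_iv (j := 2) (l := 1) (by decide) n (4) (by norm_num [nd0, nd1, nd2]))) 1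
    convert h using 1
    norm_num [nd0, nd1, nd2]

lemma nd_int (j : Fin 3) : ∃ a : ℤ, (a : ℝ) = nd j := by
  fin_cases j
  · exact ⟨0, by simp [nd]⟩
  · exact ⟨1, by simp [nd]⟩
  · exact ⟨4, by simp [nd]⟩

lemma JJ_Zs (n : ℕ) (j : Fin 3) : JJ n 1 (Zs j) := by
  intro s _
  obtain ⟨a, ha⟩ := nd_int j
  rcases s with _ | _ | s
  · exact ⟨a, by simp [Zs, ha]⟩
  · exact ⟨12, by simp [Zs]⟩
  · exact ⟨0, by simp [Zs, coeff_X]⟩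

lemma y_pos (j : Fin 3) (x : ℝ) (hx : 0 < x) : 1 ≤ 1 + nd j * x := by
  have := mul_nonneg (nd_bd j).1 hx.le
  linarith

lemma JJ_gg (ν : ℕ) (Xi : ℤ) (hX : 0 < Xi) (j : Fin 3) :
    JJ (ν + 1) ((Xi : ℝ) ^ ν) (gg ν (1 / Xi) j) := by
  intro s hs
  obtain ⟨a, ha⟩ := nd_int j
  obtain ⟨b, hb⟩ := bb_int (ν + 1) s
  have hX' : (0 : ℝ) < Xi := by exact_mod_cast hX
  have hy := y_pos j (1 / Xi) (by positivity)
  refine ⟨3 ^ s * b * (Xi + a) ^ (ν - s), ?_⟩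
  push_cast
  rw [gg, coeff_mk, hb, ha]
  have e : ∀ u : ℝ, u ^ ν = u ^ (ν - s) * u ^ s := by
    intro u; rw [← pow_add]; congr 1; omega
  have e1 : (Xi : ℝ) + nd j = Xi * (1 + nd j * (1 / Xi)) := by field_simp
  rw [e1, e (Xi : ℝ), e (1 + nd j * (1 / (Xi : ℝ))), mul_pow, div_pow, div_pow, one_pow]
  have e12 : (12 : ℝ) ^ s = 3 ^ s * 4 ^ s := by rw [← mul_pow]; norm_num
  rw [e12]
  have hy' : (1 + nd j * (1 / (Xi : ℝ))) ^ s ≠ 0 := by positivity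
  have hXs : (Xi : ℝ) ^ s ≠ 0 := by positivity
  generalize (1 + nd j * (1 / (Xi : ℝ))) = w at *
  field_simp

lemma pt_int (ν : ℕ) (Xi : ℤ) (hX : 0 < Xi) (t : ℕ) (j : Fin 3) :
    ∃ z : ℤ, (z : ℝ) = 144 ^ (ν + 1) * (Xi : ℝ) ^ ν * pt ν (1 / Xi) t j := by
  obtain ⟨z, hz⟩ := JJ_mul (JJ_mul (JJ_pow (JJ_Zs (ν + 1) j) t) (JJ_pow (JJ_II (ν + 1) j) (ν + 1)))
    (JJ_gg ν Xi hX j) ν (by omega)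
  refine ⟨12 * z, ?_⟩
  push_cast
  rw [hz]
  unfold pt
  have e12 : (144 : ℝ) ^ (ν + 1) = 12 ^ (ν + 1) * 12 ^ (ν + 1) := by rw [← mul_pow]; norm_num
  rw [e12]
  simp only [one_pow]
  ring

/-- truncated weighted norm -/
noncomputable def tn (n : ℕ) (F : PowerSeries ℝ) : ℝ :=
  ∑ s ∈ Finset.range n, |coeff s F| * (1 / 2) ^ s

lemma tn_nonneg (n : ℕ) (F : PowerSeries ℝ) : 0 ≤ tn n F :=
  Finset.sum_nonneg fun _ _ => by positivity

lemma tn_mul (n : ℕ) (F G : PowerSeries ℝ) : tn n (F * G) ≤ tn n F * tn n G := by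
  unfold tn
  rw [Finset.sum_mul_sum, ← Finset.sum_product']
  have h1 : ∑ s ∈ Finset.range n, |coeff s (F * G)| * (1 / 2) ^ s ≤
      ∑ s ∈ Finset.range n, ∑ p ∈ Finset.HasAntidiagonal.antidiagonal s,
        (|coeff p.1 F| * (1 / 2) ^ p.1) * (|coeff p.2 G| * (1 / 2) ^ p.2) := by
    apply Finset.sum_le_sum
    intro s _
    rw [coeff_mul]
    refine (mul_le_mul_of_nonneg_right (Finset.abs_sum_le_sum_abs _ _) (by positivity)).trans ?_
    rw [Finset.sum_mul]
    apply le_of_eq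
    apply Finset.sum_congr rfl
    rintro ⟨i, l⟩ hil
    rw [Finset.HasAntidiagonal.mem_antidiagonal] at hil
    simp only at hil ⊢
    rw [abs_mul, ← hil, pow_add]; ring
  refine h1.trans ?_
  rw [Finset.sum_sigma']
  refine (le_of_eq ?_).trans (Finset.sum_le_sum_of_subset_of_nonneg
    (s := ((Finset.range n).sigma fun s => Finset.HasAntidiagonal.antidiagonal s).image (fun a => a.2)) ?_ ?_)
  · rw [Finset.sum_image]
    rintro ⟨s, i, l⟩ h ⟨s', i', l'⟩ h' he
    simp only [Finset.coe_sigma, Set.mem_sigma_iff, Finset.mem_coe,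
      Finset.HasAntidiagonal.mem_antidiagonal, Prod.mk.injEq] at h h' he
    obtain ⟨rfl, rfl⟩ := he
    obtain ⟨_, rfl⟩ := h
    obtain ⟨_, rfl⟩ := h'
    rfl
  · intro p hp
    simp only [Finset.mem_image, Finset.mem_sigma, Finset.mem_range,
      Finset.HasAntidiagonal.mem_antidiagonal] at hp
    obtain ⟨⟨s, q⟩, ⟨h1, h2⟩, rfl⟩ := hp
    simp only [Finset.mem_product, Finset.mem_range] at *
    omega
  · intro p _ _; positivity

lemma tn_one (n : ℕ) : tn n 1 ≤ 1 := by
  unfold tn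
  rcases n with _ | n
  · simp
  · rw [Finset.sum_range_succ']
    simp [coeff_one]

lemma tn_pow (n : ℕ) (F : PowerSeries ℝ) (m : ℕ) : tn n (F ^ m) ≤ tn n F ^ m := by
  induction m with
  | zero => simpa using tn_one n
  | succ m ih =>
    rw [pow_succ, pow_succ]
    exact (tn_mul _ _ _).trans (mul_le_mul_of_nonneg_right ih (tn_nonneg _ _))

lemma tn_iv {j l : Fin 3} (h : j ≠ l) (A M : ℝ) (hA : |nd j - nd l| = A) (hA1 : 1 ≤ A)
    (hM : M * (A - 1 / 2) = 1) (n : ℕ) : tn n (iv j l) ≤ M := by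
  have hM0 : 0 ≤ M := by
    by_contra hc
    push Not at hc
    nlinarith
  induction n with
  | zero => simpa [tn] using hM0
  | succ n ih =>
    unfold tn at ih ⊢
    rw [Finset.sum_range_succ']
    have h0 := congrArg abs (iv_coeff_zero h)
    rw [abs_mul, hA, abs_one] at h0
    have hs : A * ∑ s ∈ Finset.range n, |coeff (s + 1) (iv j l)| * (1 / 2 : ℝ) ^ (s + 1) =
        1 / 2 * ∑ s ∈ Finset.range n, |coeff s (iv j l)| * (1 / 2) ^ s := by
      rw [Finset.mul_sum, Finset.mul_sum]
      apply Finset.sum_congr rfl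
      intro s _
      have h2 := congrArg abs (iv_coeff_succ h s)
      rw [abs_mul, hA, abs_neg] at h2
      rw [pow_succ]
      linear_combination (1 / 2 : ℝ) ^ s * (1 / 2) * h2
    rw [pow_zero, mul_one]
    have hA0 : 0 < A := by linarith
    apply le_of_mul_le_mul_left _ hA0
    rw [mul_add, hs, h0]
    nlinarith

lemma tn_II (n : ℕ) (j : Fin 3) : tn n (II j) ≤ 4 / 5 := by
  unfold II
  fin_cases j
  · have e : (Finset.univ.erase (0 : Fin 3)) = {1, 2} := by decide
    simp only [Fin.zero_eta, e]
    rw [Finset.prod_pair (by decide)]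
    have h1 := tn_iv (j := 0) (l := 1) (by decide) 1 2 (by norm_num [nd0, nd1]) (by norm_num) (by norm_num) n
    have h2 := tn_iv (j := 0) (l := 2) (by decide) 4 (2 / 7) (by norm_num [nd0, nd2]) (by norm_num) (by norm_num) n
    refine (tn_mul _ _ _).trans ((mul_le_mul h1 h2 (tn_nonneg _ _) (by norm_num)).trans (by norm_num))
  · have e : (Finset.univ.erase (1 : Fin 3)) = {0, 2} := by decide
    simp only [Fin.mk_one, e]
    rw [Finset.prod_pair (by decide)]
    have h1 := tn_iv (j := 1) (l := 0) (by decide) 1 2 (by norm_num [nd0, nd1]) (by norm_num) (by norm_num) n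
    have h2 := tn_iv (j := 1) (l := 2) (by decide) 3 (2 / 5) (by norm_num [nd1, nd2]) (by norm_num) (by norm_num) n
    refine (tn_mul _ _ _).trans ((mul_le_mul h1 h2 (tn_nonneg _ _) (by norm_num)).trans (by norm_num))
  · have e : (Finset.univ.erase (2 : Fin 3)) = {0, 1} := by decide
    simp only [Fin.reduceFinMk, e]
    rw [Finset.prod_pair (by decide)]
    have h1 := tn_iv (j := 2) (l := 0) (by decide) 4 (2 / 7) (by norm_num [nd0, nd2]) (by norm_num) (by norm_num) n
    have h2 := tn_iv (j := 2) (l := 1) (by decide) 3 (2 / 5) (by norm_num [nd1, nd2]) (by norm_num) (by norm_num) n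
    refine (tn_mul _ _ _).trans ((mul_le_mul h1 h2 (tn_nonneg _ _) (by norm_num)).trans (by norm_num))

lemma tn_Zs (n : ℕ) (j : Fin 3) : tn n (Zs j) ≤ 9 / 2 := by
  unfold tn
  have hb := nd_bd j
  rcases n with _ | _ | n
  · simp; norm_num
  · simp [Zs, abs_of_nonneg hb.1]; linarith
  · rw [Finset.sum_range_succ', Finset.sum_range_succ']
    have : ∀ s, coeff (s + 1 + 1) (Zs j) = 0 := by
      intro s; simp [Zs, coeff_X]
    simp only [this]
    simp [Zs, abs_of_nonneg hb.1]
    linarith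

lemma tn_gg (ν : ℕ) (x : ℝ) (hx : 0 < x) (hx4 : x < 1) (j : Fin 3) :
    tn (ν + 1) (gg ν x j) ≤ 2 ^ (ν + 1) * (1 + nd j * x) ^ ν * 2 := by
  have hy := y_pos j x hx
  unfold tn
  have h1 : ∀ s ∈ Finset.range (ν + 1), |coeff s (gg ν x j)| * (1 / 2 : ℝ) ^ s ≤
      2 ^ (ν + 1) * (1 + nd j * x) ^ ν * (1 / 2) ^ s := by
    intro s _
    apply mul_le_mul_of_nonneg_right _ (by positivity)
    rw [gg, coeff_mk, abs_mul, abs_mul, abs_of_nonneg (by positivity : 0 ≤ (1 + nd j * x) ^ ν),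
      abs_of_nonneg (by positivity : 0 ≤ (x / (1 + nd j * x)) ^ s)]
    have h2 : (x / (1 + nd j * x)) ^ s ≤ 1 := by
      apply pow_le_one₀ (by positivity)
      rw [div_le_one (by linarith)]; linarith
    have h3 := bb_abs (ν + 1) s
    calc _ ≤ |bb (ν + 1) s| * (1 + nd j * x) ^ ν * 1 :=
          mul_le_mul_of_nonneg_left h2 (by positivity)
      _ ≤ _ := by rw [mul_one]; exact mul_le_mul_of_nonneg_right h3 (by positivity)
  refine (Finset.sum_le_sum h1).trans ?_
  rw [← Finset.mul_sum]
  apply mul_le_mul_of_nonneg_left _ (by positivity)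
  have := geom_sum_eq (by norm_num : (1 / 2 : ℝ) ≠ 1) (ν + 1)
  rw [this]
  have h4 : (0 : ℝ) < (1 / 2) ^ (ν + 1) := by positivity
  have e : (((1 / 2 : ℝ)) ^ (ν + 1) - 1) / (1 / 2 - 1) = 2 * (1 - (1 / 2) ^ (ν + 1)) := by ring
  rw [e]
  linarith

lemma coeff_le_tn (ν : ℕ) (F : PowerSeries ℝ) : |coeff ν F| ≤ 2 ^ ν * tn (ν + 1) F := by
  have h : |coeff ν F| * (1 / 2 : ℝ) ^ ν ≤ tn (ν + 1) F := by
    unfold tn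
    exact Finset.single_le_sum (f := fun s => |coeff s F| * (1 / 2 : ℝ) ^ s) (fun _ _ => by positivity)
      (Finset.mem_range.2 (by omega))
  have h2 := mul_le_mul_of_nonneg_left h (by positivity : (0 : ℝ) ≤ 2 ^ ν)
  have e : (2 : ℝ) ^ ν * (1 / 2) ^ ν = 1 := by rw [← mul_pow]; norm_num
  calc |coeff ν F| = (2 : ℝ) ^ ν * (1 / 2) ^ ν * |coeff ν F| := by rw [e, one_mul]
    _ = 2 ^ ν * (|coeff ν F| * (1 / 2) ^ ν) := by ring
    _ ≤ _ := h2

lemma pt_bound (ν : ℕ) (X : ℝ) (hX : 313632 ≤ X) (t : ℕ) (ht : t ≤ 2) (j : Fin 3) :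
    144 ^ (ν + 1) * X ^ ν * |pt ν (1 / X) t j| ≤ 21 * (462 * X) ^ (ν + 1) := by
  have hX0 : 0 < X := by linarith
  have hx : 0 < 1 / X := by positivity
  have hx1 : 1 / X ≤ 1 / 313632 := one_div_le_one_div_of_le (by norm_num) hX
  have hy := y_pos j (1 / X) hx
  have hy2 : 1 + nd j * (1 / X) ≤ 1 + 4 / 313632 := by
    have := mul_le_mul (nd_bd j).2 hx1 hx.le (by norm_num)
    linarith
  have hZ : tn (ν + 1) (Zs j ^ t) ≤ 21 := by
    refine (tn_pow _ _ _).trans ((pow_le_pow_left₀ (tn_nonneg _ _) (tn_Zs _ _) t).trans ?_)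
    interval_cases t <;> norm_num
  have hI : tn (ν + 1) (II j ^ (ν + 1)) ≤ (4 / 5) ^ (ν + 1) :=
    (tn_pow _ _ _).trans (pow_le_pow_left₀ (tn_nonneg _ _) (tn_II _ _) _)
  have hg := tn_gg ν (1 / X) hx (by linarith) j
  have h1 : tn (ν + 1) (Zs j ^ t * II j ^ (ν + 1) * gg ν (1 / X) j) ≤
      21 * (4 / 5) ^ (ν + 1) * (2 ^ (ν + 1) * (1 + nd j * (1 / X)) ^ ν * 2) :=
    (tn_mul _ _ _).trans (mul_le_mul ((tn_mul _ _ _).trans (mul_le_mul hZ hI (tn_nonneg _ _) (by norm_num)))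
      hg (tn_nonneg _ _) (by positivity))
  have h2 := (coeff_le_tn ν _).trans (mul_le_mul_of_nonneg_left h1 (by positivity : (0 : ℝ) ≤ 2 ^ ν))
  change |pt ν (1 / X) t j| ≤ _ at h2
  set y := 1 + nd j * (1 / X)
  have h3 : (y : ℝ) ^ ν ≤ (1 + 4 / 313632) ^ (ν + 1) :=
    (pow_le_pow_left₀ (by linarith) hy2 ν).trans (pow_le_pow_right₀ (by norm_num) (by omega))
  calc 144 ^ (ν + 1) * X ^ ν * |pt ν (1 / X) t j|
      ≤ 144 ^ (ν + 1) * X ^ ν * (2 ^ ν * (21 * (4 / 5) ^ (ν + 1) * (2 ^ (ν + 1) * y ^ ν * 2))) :=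
        mul_le_mul_of_nonneg_left h2 (by positivity)
    _ = 21 * (144 ^ (ν + 1) * (4 / 5) ^ (ν + 1) * 2 ^ (ν + 1) * 2 ^ (ν + 1)) * (X ^ ν * y ^ ν) := by
        rw [pow_succ (2 : ℝ)]; ring
    _ ≤ 21 * (144 ^ (ν + 1) * (4 / 5) ^ (ν + 1) * 2 ^ (ν + 1) * 2 ^ (ν + 1)) *
        (X ^ (ν + 1) * (1 + 4 / 313632) ^ (ν + 1)) := by
        apply mul_le_mul_of_nonneg_left _ (by positivity)
        exact mul_le_mul (pow_le_pow_right₀ (by linarith) (by omega)) h3 (by positivity) (by positivity)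
    _ = 21 * ((144 * (4 / 5) * 2 * 2 * (1 + 4 / 313632)) * X) ^ (ν + 1) := by
        rw [mul_pow, mul_pow, mul_pow, mul_pow, mul_pow]; ring
    _ ≤ 21 * (462 * X) ^ (ν + 1) := by
        apply mul_le_mul_of_nonneg_left _ (by norm_num)
        apply pow_le_pow_left₀ (by positivity)
        apply mul_le_mul_of_nonneg_right _ hX0.le
        norm_num

lemma lam_const (ν H : ℕ) : lam (fun _ => ν + 1) H = ∑ j, coeff ν (Zs j ^ H * II j ^ (ν + 1)) := by
  unfold lam
  apply Finset.sum_congr rfl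
  intro j _
  rw [coeff_succ_X_mul, Finset.prod_pow]
  rfl

lemma rem_hasSum (ν t : ℕ) (x : ℝ) (hx : 0 < x) (hx4 : 4 * x < 1) :
    HasSum (fun h => bb (ν + 1) h * x ^ h * lam (fun _ => ν + 1) (t + h))
      (∑ j, Real.sqrt (1 + nd j * x) * pt ν x t j) := by
  have key : ∀ j : Fin 3, HasSum (fun h => bb (ν + 1) h * x ^ h * coeff ν (Zs j ^ (t + h) * II j ^ (ν + 1)))
      (Real.sqrt (1 + nd j * x) * pt ν x t j) := by
    intro j
    have h1 : HasSum (fun h => ∑ p ∈ Finset.HasAntidiagonal.antidiagonal ν,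
        coeff p.1 (Zs j ^ t * II j ^ (ν + 1)) * (bb (ν + 1) h * x ^ h * coeff p.2 (Zs j ^ h)))
        (∑ p ∈ Finset.HasAntidiagonal.antidiagonal ν, coeff p.1 (Zs j ^ t * II j ^ (ν + 1)) *
          (Real.sqrt (1 + nd j * x) * (bb (ν + 1) p.2 * (1 + nd j * x) ^ ν * (x / (1 + nd j * x)) ^ p.2))) := by
      apply hasSum_sum
      rintro ⟨i, l⟩ hil
      rw [Finset.HasAntidiagonal.mem_antidiagonal] at hil
      simp only at hil ⊢
      exact (binser_shift ν l j x hx hx4 (by omega)).mul_left _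
    have e1 : (fun h => bb (ν + 1) h * x ^ h * coeff ν (Zs j ^ (t + h) * II j ^ (ν + 1))) =
        (fun h => ∑ p ∈ Finset.HasAntidiagonal.antidiagonal ν,
        coeff p.1 (Zs j ^ t * II j ^ (ν + 1)) * (bb (ν + 1) h * x ^ h * coeff p.2 (Zs j ^ h))) := by
      funext h
      have : Zs j ^ (t + h) * II j ^ (ν + 1) = (Zs j ^ t * II j ^ (ν + 1)) * Zs j ^ h := by
        rw [pow_add]; ring
      rw [this, coeff_mul, Finset.mul_sum]
      apply Finset.sum_congr rfl
      intro p _; ring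
    have e2 : Real.sqrt (1 + nd j * x) * pt ν x t j =
        (∑ p ∈ Finset.HasAntidiagonal.antidiagonal ν, coeff p.1 (Zs j ^ t * II j ^ (ν + 1)) *
          (Real.sqrt (1 + nd j * x) * (bb (ν + 1) p.2 * (1 + nd j * x) ^ ν * (x / (1 + nd j * x)) ^ p.2))) := by
      unfold pt
      rw [coeff_mul, Finset.mul_sum]
      apply Finset.sum_congr rfl
      intro p _
      rw [gg, coeff_mk]; ring
    rw [e1, e2]
    exact h1
  have h := hasSum_sum (s := Finset.univ) (fun j _ => key j)
  convert h using 2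
  rename_i h
  rw [lam_const, Finset.mul_sum]

lemma rem_bound (ν t : ℕ) (ht : t ≤ 2) (hν : 1 ≤ ν) (x : ℝ) (hx : 0 < x) (hx4 : 4 * x < 1) :
    |∑ j, Real.sqrt (1 + nd j * x) * pt ν x t j| ≤ x ^ (3 * ν) * (1 / (1 - 4 * x) ^ (3 * ν + 3)) := by
  have h := rem_hasSum ν t x hx hx4
  have hκ : ∑ _j : Fin 3, (ν + 1) = (3 * ν + 2) + 1 := by simp; ring
  have hl := fun H => lam_bound H (3 * ν + 2) (fun _ => ν + 1) hκ
  rw [← hasSum_nat_add_iff' (3 * ν + 2 - t)] at h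
  have hz : ∑ i ∈ Finset.range (3 * ν + 2 - t), bb (ν + 1) i * x ^ i * lam (fun _ => ν + 1) (t + i) = 0 := by
    apply Finset.sum_eq_zero
    intro i hi
    rw [Finset.mem_range] at hi
    obtain ⟨h1, h2⟩ := hl (t + i)
    rw [Nat.choose_eq_zero_of_lt (by omega)] at h2
    have h3 : (0 : ℝ) < 4 ^ (3 * ν + 2) := by positivity
    have : lam (fun _ => ν + 1) (t + i) = 0 := by
      apply le_antisymm _ h1
      by_contra hc
      push Not at hc
      have := mul_pos hc h3
      simp at h2
      linarith
    rw [this, mul_zero]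
  rw [hz, sub_zero] at h
  have hg := (hasSum_choose_mul_geometric_of_norm_lt_one (3 * ν + 2) (r := 4 * x)
    (by rw [Real.norm_eq_abs, abs_of_pos (by linarith)]; exact hx4)).mul_left (x ^ (3 * ν))
  have := h.norm_le_of_bounded hg ?_
  · simpa using this
  · intro i
    rw [Real.norm_eq_abs]
    have e : t + (i + (3 * ν + 2 - t)) = i + (3 * ν + 2) := by omega
    rw [e]
    obtain ⟨h1, h2⟩ := hl (i + (3 * ν + 2))
    rw [abs_mul, abs_mul, abs_of_nonneg h1, abs_of_nonneg (by positivity : 0 ≤ x ^ (i + (3 * ν + 2 - t)))]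
    have hb := bb_abs_one (ν + 1) (i + (3 * ν + 2 - t)) (by omega)
    have h3 : lam (fun _ => ν + 1) (i + (3 * ν + 2)) ≤ (i + (3 * ν + 2)).choose (3 * ν + 2) * 4 ^ i := by
      rw [pow_add 4 i (3 * ν + 2), ← mul_assoc] at h2
      exact le_of_mul_le_mul_right h2 (by positivity)
    have h4 : x ^ (i + (3 * ν + 2 - t)) ≤ x ^ (i + 3 * ν) :=
      pow_le_pow_of_le_one hx.le (by linarith) (by omega)
    calc |bb (ν + 1) (i + (3 * ν + 2 - t))| * x ^ (i + (3 * ν + 2 - t)) * lam (fun _ => ν + 1) (i + (3 * ν + 2))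
        ≤ (1 * x ^ (i + 3 * ν)) * ((i + (3 * ν + 2)).choose (3 * ν + 2) * 4 ^ i) :=
          mul_le_mul (mul_le_mul hb h4 (by positivity) (by norm_num)) h3 h1 (by positivity)
      _ = _ := by rw [mul_pow, pow_add]; ring

noncomputable def BB (j : Fin 3) : PowerSeries ℝ := ∏ l ∈ Finset.univ.erase j, (C (nd j - nd l) + X)

lemma BB_II (j : Fin 3) : BB j * II j = 1 := by
  unfold BB II
  rw [← Finset.prod_mul_distrib]
  apply Finset.prod_eq_one
  intro l hl
  exact iv_mul (Finset.ne_of_mem_erase hl).symm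

lemma X_BB (j : Fin 3) : X * BB j = Zs j * (Zs j ^ 2 - 5 * Zs j + 4) := by
  have e5 : (5 : PowerSeries ℝ) = C 5 := (map_ofNat C 5).symm
  have e4 : (4 : PowerSeries ℝ) = C 4 := (map_ofNat C 4).symm
  have e3 : (3 : PowerSeries ℝ) = C 3 := (map_ofNat C 3).symm
  unfold BB Zs
  fin_cases j
  · have e : (Finset.univ.erase (0 : Fin 3)) = {1, 2} := by decide
    simp only [Fin.zero_eta, e]
    rw [Finset.prod_pair (by decide)]
    simp only [nd0, nd1, nd2, map_sub, map_zero, map_one, ← e4]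
    ring
  · have e : (Finset.univ.erase (1 : Fin 3)) = {0, 2} := by decide
    simp only [Fin.mk_one, e]
    rw [Finset.prod_pair (by decide)]
    simp only [nd0, nd1, nd2, map_sub, map_zero, map_one, ← e4]
    ring
  · have e : (Finset.univ.erase (2 : Fin 3)) = {0, 1} := by decide
    simp only [Fin.reduceFinMk, e]
    rw [Finset.prod_pair (by decide)]
    simp only [nd0, nd1, nd2, map_sub, map_zero, map_one, ← e4]
    ring

lemma d_Zs (j : Fin 3) : d⁄dX ℝ (Zs j) = 1 := by simp [Zs]

lemma d_Zs_pow (j : Fin 3) (t : ℕ) : d⁄dX ℝ (Zs j ^ t) * Zs j = t * Zs j ^ t := by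
  rw [derivative_pow, d_Zs]
  rcases t with _ | t
  · simp
  · rw [Nat.add_sub_cancel, pow_succ]; ring

lemma d_II (j : Fin 3) : d⁄dX ℝ (II j) = - (II j ^ 2 * d⁄dX ℝ (BB j)) := by
  have h := congrArg (d⁄dX ℝ) (BB_II j)
  rw [Derivation.leibniz, derivative_one] at h
  simp only [smul_eq_mul] at h
  linear_combination II j * h - d⁄dX ℝ (II j) * BB_II j

lemma d_II_pow (j : Fin 3) (ν : ℕ) :
    d⁄dX ℝ (II j ^ ν) = - (ν * II j ^ (ν + 1) * d⁄dX ℝ (BB j)) := by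
  rw [derivative_pow, d_II]
  rcases ν with _ | ν
  · simp
  · rw [Nat.add_sub_cancel]; ring

lemma d_XBB (j : Fin 3) : X * d⁄dX ℝ (BB j) + BB j = 3 * Zs j ^ 2 - 10 * Zs j + 4 := by
  have h := congrArg (d⁄dX ℝ) (X_BB j)
  have e : Zs j * (Zs j ^ 2 - 5 * Zs j + 4) = Zs j ^ 3 - (C 5) * Zs j ^ 2 + C 4 * Zs j := by
    have e5 : (5 : PowerSeries ℝ) = C 5 := (map_ofNat C 5).symm
    have e4 : (4 : PowerSeries ℝ) = C 4 := (map_ofNat C 4).symm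
    rw [← e5, ← e4]; ring
  rw [e] at h
  simp only [map_add, map_sub, Derivation.leibniz, derivative_pow, d_Zs, derivative_C, derivative_X, smul_eq_mul] at h
  have e5 : (C (5 : ℝ) : PowerSeries ℝ) = 5 := map_ofNat C 5
  have e4 : (C (4 : ℝ) : PowerSeries ℝ) = 4 := map_ofNat C 4
  rw [e5, e4] at h
  push_cast at h
  linear_combination h

lemma ode (ν : ℕ) (x : ℝ) (hx : 0 < x) (j : Fin 3) :
    (1 + C x * Zs j) * d⁄dX ℝ (gg ν x j) = C ((ν + 1 / 2) * x) * gg ν x j := by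
  have hy := y_pos j x hx
  have e : (1 + C x * Zs j) = C (1 + nd j * x) + C x * X := by
    unfold Zs; simp only [map_add, map_one, map_mul]; ring
  rw [e]
  ext s
  have hb := bb_succ (ν + 1) s
  rw [add_mul, map_add, coeff_C_mul, coeff_C_mul, mul_assoc, coeff_C_mul, coeff_derivative]
  set y := 1 + nd j * x
  have hy0 : y ≠ 0 := by positivity
  rcases s with _ | s
  · simp only [coeff_zero_X_mul, gg, coeff_mk]
    push_cast at hb ⊢
    have : y * (x / y) = x := by field_simp
    simp only [pow_zero, pow_one, zero_add] at *
    change y * (bb (ν + 1) 1 * y ^ ν * (x / y) * 1) + x * 0 = _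
    have e2 : y * (bb (ν + 1) 1 * y ^ ν * (x / y) * 1) = bb (ν + 1) 1 * y ^ ν * (y * (x / y)) := by ring
    rw [e2, this]
    change _ = (ν + 1 / 2) * x * (bb (ν + 1) 0 * y ^ ν * 1)
    linear_combination y ^ ν * x * hb
  · rw [coeff_succ_X_mul, coeff_derivative]
    simp only [gg, coeff_mk]
    change y * (bb (ν + 1) (s + 1 + 1) * y ^ ν * (x / y) ^ (s + 1 + 1) * _) +
      x * (bb (ν + 1) (s + 1) * y ^ ν * (x / y) ^ (s + 1) * _) = (ν + 1 / 2) * x * (bb (ν + 1) (s + 1) * y ^ ν * (x / y) ^ (s + 1))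
    have : y * (x / y) = x := by field_simp
    push_cast at hb ⊢
    rw [pow_succ (x / y) (s + 1)]
    linear_combination y ^ ν * (x / y) ^ (s + 1) * x * hb +
      bb (ν + 1) (s + 1 + 1) * y ^ ν * (x / y) ^ (s + 1) * ((s : ℝ) + 1 + 1) * this

lemma rec_series (ν t : ℕ) (x : ℝ) (hx : 0 < x) (j : Fin 3) :
    coeff ν (Zs j ^ t * ((1 + C x * Zs j) * ((t : PowerSeries ℝ) * (Zs j ^ 2 - 5 * Zs j + 4) - (ν : PowerSeries ℝ) * (3 * Zs j ^ 2 - 10 * Zs j + 4)) +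
      C ((ν + 3 / 2) * x) * (Zs j * (Zs j ^ 2 - 5 * Zs j + 4))) * II j ^ (ν + 1) * gg ν x j) = 0 := by
  set W := Zs j ^ t * (1 + C x * Zs j) * gg ν x j * II j ^ ν with hW
  have h0 : coeff ν (X * d⁄dX ℝ W - (ν : PowerSeries ℝ) * W) = 0 := by
    have e : (ν : PowerSeries ℝ) = C (ν : ℝ) := by simp
    rw [map_sub, e, coeff_C_mul]
    rcases ν with _ | ν
    · simp
    · rw [coeff_succ_X_mul, coeff_derivative]; push_cast; ring
  rw [← h0]
  congr 1
  have hd : d⁄dX ℝ W = Zs j ^ t * (1 + C x * Zs j) * gg ν x j * d⁄dX ℝ (II j ^ ν) +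
      (Zs j ^ t * (1 + C x * Zs j) * d⁄dX ℝ (gg ν x j) + (Zs j ^ t * C x + d⁄dX ℝ (Zs j ^ t) * (1 + C x * Zs j)) * gg ν x j) * II j ^ ν := by
    rw [hW]
    simp only [Derivation.leibniz, map_add, derivative_one, derivative_C, d_Zs, smul_eq_mul]
    ring
  rw [hd, d_II_pow]
  have hode := ode ν x hx j
  have hZ := d_Zs_pow j t
  have hX := X_BB j
  have hXB := d_XBB j
  have hBI := BB_II j
  have eC : (C ((ν + 3 / 2) * x) : PowerSeries ℝ) = C ((ν + 1 / 2) * x) + C x := by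
    rw [← map_add]; congr 1; ring
  rw [eC]
  rw [pow_succ (II j) ν, hW]
  generalize (C ((ν + 1 / 2) * x) : PowerSeries ℝ) = c1 at *
  generalize (C x : PowerSeries ℝ) = cx at *
  generalize d⁄dX ℝ (gg ν x j) = dg at *
  generalize gg ν x j = g at *
  generalize d⁄dX ℝ (BB j) = dB at *
  generalize d⁄dX ℝ (Zs j ^ t) = dZ at *
  generalize Zs j ^ t = Zt at *
  generalize II j ^ ν = In at *
  generalize BB j = B at *
  generalize II j = I at *
  generalize Zs j = Z at *
  generalize (Z ^ 2 - 5 * Z + 4) = q at *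
  generalize (3 * Z ^ 2 - 10 * Z + 4) = q' at *
  generalize (X : PowerSeries ℝ) = T at *
  -- eliminate `T = Z * q * I`
  have hT : T = Z * q * I := by linear_combination I * hX - T * hBI
  linear_combination (-(T * Zt * In)) * hode - (Zt * c1 * g + Zt * cx * g + dZ * (1 + cx * Z) * g) * In * hT -
    q * I * (1 + cx * Z) * g * In * hZ + (ν : PowerSeries ℝ) * Zt * (1 + cx * Z) * g * In * (I * hXB - hBI)

lemma pt_rec (ν t : ℕ) (x : ℝ) (hx : 0 < x) (j : Fin 3) :
    (x * (t - 3 * ν) + (ν + 3 / 2) * x) * pt ν x (t + 3) j +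
    (t - 3 * ν + x * (-5 * t + 10 * ν) - 5 * ((ν + 3 / 2) * x)) * pt ν x (t + 2) j +
    (-5 * t + 10 * ν + x * (4 * t - 4 * ν) + 4 * ((ν + 3 / 2) * x)) * pt ν x (t + 1) j +
    (4 * t - 4 * ν) * pt ν x t j = 0 := by
  rw [← rec_series ν t x hx j]
  unfold pt
  rw [← coeff_C_mul, ← coeff_C_mul, ← coeff_C_mul, ← coeff_C_mul, ← map_add, ← map_add, ← map_add]
  congr 1
  have e5 : (C (5 : ℝ) : PowerSeries ℝ) = 5 := map_ofNat C 5
  have e4 : (C (4 : ℝ) : PowerSeries ℝ) = 4 := map_ofNat C 4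
  have e3 : (C (3 : ℝ) : PowerSeries ℝ) = 3 := map_ofNat C 3
  have e10 : (C (10 : ℝ) : PowerSeries ℝ) = 10 := map_ofNat C 10
  have et : (C (t : ℝ) : PowerSeries ℝ) = t := by simp
  have eν : (C (ν : ℝ) : PowerSeries ℝ) = ν := by simp
  generalize hc : (ν + 3 / 2) * x = c0
  simp only [map_add, map_sub, map_mul, map_neg, e3, e4, e5, e10, et, eν]
  ring

/-- three vanishing moments force `v 0 = 0` -/
lemma nonvanish (ν : ℕ) (x : ℝ) (hx : 0 < x) (v : Fin 3 → ℝ)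
    (h : ∀ t, t ≤ 2 → ∑ j, v j * pt ν x t j = 0) : v 0 = 0 := by
  have hall : ∀ t, ∑ j, v j * pt ν x t j = 0 := by
    intro t
    induction t using Nat.strong_induction_on with
    | _ t ih =>
      rcases t with _ | _ | _ | t
      · exact h 0 (by omega)
      · exact h 1 (by omega)
      · exact h 2 (by omega)
      · have i0 := ih t (by omega)
        have i1 := ih (t + 1) (by omega)
        have i2 := ih (t + 2) (by omega)
        rw [Fin.sum_univ_three] at i0 i1 i2 ⊢
        have r0 := pt_rec ν t x hx 0
        have r1 := pt_rec ν t x hx 1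
        have r2 := pt_rec ν t x hx 2
        have hne : (x * (t - 3 * ν) + (ν + 3 / 2) * x) ≠ 0 := by
          have e : (x * (t - 3 * ν) + (ν + 3 / 2) * x) = x * (((2 * t + 3 - 4 * ν : ℤ) : ℝ) / 2) := by
            push_cast; ring
          rw [e]
          apply mul_ne_zero hx.ne'
          apply div_ne_zero _ (by norm_num)
          rw [Int.cast_ne_zero]
          omega
        apply (mul_eq_zero.1 (_ : (x * (t - 3 * ν) + (ν + 3 / 2) * x) * _ = 0)).resolve_left hne
        linear_combination v 0 * r0 + v 1 * r1 + v 2 * r2 -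
          (t - 3 * ν + x * (-5 * t + 10 * ν) - 5 * ((ν + 3 / 2) * x)) * i2 -
          (-5 * t + 10 * ν + x * (4 * t - 4 * ν) + 4 * ((ν + 3 / 2) * x)) * i1 -
          (4 * t - 4 * ν) * i0
  have hpoly : ∀ q : Polynomial ℝ, ∑ j, v j * coeff ν (Polynomial.aeval (Zs j) q * II j ^ (ν + 1) * gg ν x j) = 0 := by
    intro q
    induction q using Polynomial.induction_on' with
    | add p q hp hq =>
      simp only [map_add, add_mul, mul_add, Finset.sum_add_distrib]
      rw [hp, hq, add_zero]
    | monomial n a =>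
      have e : ∀ j, v j * coeff ν (Polynomial.aeval (Zs j) (Polynomial.monomial n a) * II j ^ (ν + 1) * gg ν x j) =
          a * (v j * pt ν x n j) := by
        intro j
        have : Polynomial.aeval (Zs j) (Polynomial.monomial n a) * II j ^ (ν + 1) * gg ν x j =
            C a * (Zs j ^ n * II j ^ (ν + 1) * gg ν x j) := by
          rw [Polynomial.aeval_monomial, PowerSeries.algebraMap_eq]; ring
        rw [this, coeff_C_mul, pt]; ring
      rw [Finset.sum_congr rfl (fun j _ => e j), ← Finset.mul_sum, hall, mul_zero]
  have h1 := hpoly (Polynomial.X ^ ν * ((Polynomial.X - Polynomial.C 1) * (Polynomial.X - Polynomial.C 4)) ^ (ν + 1))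
  simp only [map_mul, map_pow, map_sub, Polynomial.aeval_X, Polynomial.aeval_C, PowerSeries.algebraMap_eq] at h1
  rw [Fin.sum_univ_three] at h1
  have hZ0 : Zs 0 = X := by simp [Zs, nd0]
  have hZ1 : Zs 1 - C 1 = X := by simp [Zs, nd1]
  have hZ2 : Zs 2 - C 4 = X := by simp [Zs, nd2]
  have t1 : coeff ν (Zs 1 ^ ν * ((Zs 1 - C 1) * (Zs 1 - C 4)) ^ (ν + 1) * II 1 ^ (ν + 1) * gg ν x 1) = 0 := by
    have : Zs 1 ^ ν * ((Zs 1 - C 1) * (Zs 1 - C 4)) ^ (ν + 1) * II 1 ^ (ν + 1) * gg ν x 1 =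
        X ^ (ν + 1) * (Zs 1 ^ ν * (Zs 1 - C 4) ^ (ν + 1) * II 1 ^ (ν + 1) * gg ν x 1) := by
      rw [hZ1, mul_pow]; ring
    rw [this, coeff_X_pow_mul', if_neg (by omega)]
  have t2 : coeff ν (Zs 2 ^ ν * ((Zs 2 - C 1) * (Zs 2 - C 4)) ^ (ν + 1) * II 2 ^ (ν + 1) * gg ν x 2) = 0 := by
    have : Zs 2 ^ ν * ((Zs 2 - C 1) * (Zs 2 - C 4)) ^ (ν + 1) * II 2 ^ (ν + 1) * gg ν x 2 =
        X ^ (ν + 1) * (Zs 2 ^ ν * (Zs 2 - C 1) ^ (ν + 1) * II 2 ^ (ν + 1) * gg ν x 2) := by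
      rw [hZ2, mul_pow]; ring
    rw [this, coeff_X_pow_mul', if_neg (by omega)]
  have t0 : coeff ν (Zs 0 ^ ν * ((Zs 0 - C 1) * (Zs 0 - C 4)) ^ (ν + 1) * II 0 ^ (ν + 1) * gg ν x 0) = 1 := by
    have hB : (Zs 0 - C 1) * (Zs 0 - C 4) = BB 0 := by
      unfold BB
      have e : (Finset.univ.erase (0 : Fin 3)) = {1, 2} := by decide
      rw [e, Finset.prod_pair (by decide), hZ0, nd0, nd1, nd2, zero_sub, zero_sub, map_neg, map_neg]
      ring
    rw [hB, mul_assoc (Zs 0 ^ ν), ← mul_pow, BB_II, one_pow, mul_one, hZ0, coeff_X_pow_mul', if_pos le_rfl]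
    simp [gg, bb_zero, nd0]
  rw [t0, t1, t2] at h1
  linarith

end

lemma rickert (Xi : ℤ) (hX : 313632 ≤ Xi) (ν : ℕ) (hν : 1 ≤ ν) (v : Fin 3 → ℤ) (hv0 : 0 < v 0) (δ : ℝ)
    (h1 : |(v 1 : ℝ) - v 0 * Real.sqrt (1 + 1 / Xi)| ≤ δ)
    (h2 : |(v 2 : ℝ) - v 0 * Real.sqrt (1 + 4 / Xi)| ≤ δ) :
    1 ≤ (v 0 : ℝ) * (145 ^ (ν + 1) * (Xi : ℝ) ^ 2 / (Xi : ℝ) ^ (2 * (ν + 1))) +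
      42 * δ * (462 * (Xi : ℝ)) ^ (ν + 1) := by
  by_contra hcon
  push Not at hcon
  have hX' : (313632 : ℝ) ≤ Xi := by exact_mod_cast hX
  have hX0 : (0 : ℝ) < Xi := by linarith
  have hx : (0 : ℝ) < 1 / Xi := by positivity
  have hx1 : (1 : ℝ) / Xi ≤ 1 / 313632 := one_div_le_one_div_of_le (by norm_num) hX'
  have hv0' : (0 : ℝ) < v 0 := by exact_mod_cast hv0
  have hδ : 0 ≤ δ := (abs_nonneg _).trans h1
  have hz := nonvanish ν (1 / Xi) hx (fun j => (v j : ℝ)) ?_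
  · have hz2 : (v 0 : ℝ) = 0 := hz; linarith
  intro t ht
  obtain ⟨z0, hz0⟩ := pt_int ν Xi (by omega) t 0
  obtain ⟨z1, hz1⟩ := pt_int ν Xi (by omega) t 1
  obtain ⟨z2, hz2⟩ := pt_int ν Xi (by omega) t 2
  have hr := rem_bound ν t ht hν (1 / Xi) hx (by linarith)
  have hb1 := pt_bound ν Xi hX' t ht 1
  have hb2 := pt_bound ν Xi hX' t ht 2
  rw [Fin.sum_univ_three] at hr ⊢
  simp only [nd0, nd1, nd2, zero_mul, add_zero, Real.sqrt_one, one_mul] at hr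
  have e4 : (4 : ℝ) * (1 / Xi) = 4 / Xi := by ring
  rw [e4] at hr
  set θ1 := Real.sqrt (1 + 1 / (Xi : ℝ))
  set θ2 := Real.sqrt (1 + 4 / (Xi : ℝ))
  set p0 := pt ν (1 / Xi) t 0
  set p1 := pt ν (1 / Xi) t 1
  set p2 := pt ν (1 / Xi) t 2
  set D : ℝ := 144 ^ (ν + 1) * (Xi : ℝ) ^ ν with hD
  have hD0 : 0 < D := by positivity
  have hDr : D * |p0 + θ1 * p1 + θ2 * p2| ≤ 145 ^ (ν + 1) * (Xi : ℝ) ^ 2 / (Xi : ℝ) ^ (2 * (ν + 1)) := by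
    refine (mul_le_mul_of_nonneg_left hr hD0.le).trans ?_
    have hq : (0 : ℝ) < 1 - 4 / Xi := by rw [← e4]; linarith
    have h3 : (144 : ℝ) ≤ 145 * (1 - 4 / Xi) ^ 3 := by
      have h4 : (1 - 4 / 313632 : ℝ) ≤ 1 - 4 / Xi := by rw [← e4]; linarith
      have h5 := pow_le_pow_left₀ (by norm_num) h4 3
      have h6 : (144 : ℝ) ≤ 145 * (1 - 4 / 313632 : ℝ) ^ 3 := by norm_num
      linarith
    have h4 := pow_le_pow_left₀ (by norm_num) h3 (ν + 1)
    rw [mul_pow, ← pow_mul] at h4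
    have e3 : 3 * (ν + 1) = 3 * ν + 3 := by ring
    rw [e3] at h4
    have h5 : (144 : ℝ) ^ (ν + 1) * (1 / (1 - 4 / Xi) ^ (3 * ν + 3)) ≤ 145 ^ (ν + 1) := by
      rw [mul_one_div, div_le_iff₀ (by positivity)]; exact h4
    have h6 : (Xi : ℝ) ^ ν * (1 / Xi) ^ (3 * ν) = (Xi : ℝ) ^ 2 / (Xi : ℝ) ^ (2 * (ν + 1)) := by
      rw [div_pow, one_pow, mul_one_div, div_eq_div_iff (by positivity) (by positivity), ← pow_add, ← pow_add]
      congr 1; ring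
    calc D * ((1 / (Xi : ℝ)) ^ (3 * ν) * (1 / (1 - 4 / Xi) ^ (3 * ν + 3)))
        = (144 ^ (ν + 1) * (1 / (1 - 4 / Xi) ^ (3 * ν + 3))) * ((Xi : ℝ) ^ ν * (1 / Xi) ^ (3 * ν)) := by
          rw [hD]; ring
      _ ≤ 145 ^ (ν + 1) * ((Xi : ℝ) ^ ν * (1 / Xi) ^ (3 * ν)) :=
          mul_le_mul_of_nonneg_right h5 (by positivity)
      _ = _ := by rw [h6]; ring
  have eS : (v 0 : ℝ) * p0 + v 1 * p1 + v 2 * p2 = v 0 * (p0 + θ1 * p1 + θ2 * p2) +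
      ((v 1 - v 0 * θ1) * p1 + (v 2 - v 0 * θ2) * p2) := by ring
  have hS : D * |(v 0 : ℝ) * p0 + v 1 * p1 + v 2 * p2| < 1 := by
    refine lt_of_le_of_lt ?_ hcon
    have a1 : |(v 0 : ℝ) * p0 + v 1 * p1 + v 2 * p2| ≤ v 0 * |p0 + θ1 * p1 + θ2 * p2| + (δ * |p1| + δ * |p2|) := by
      rw [eS]
      refine (abs_add_le _ _).trans (add_le_add ?_ ((abs_add_le _ _).trans (add_le_add ?_ ?_)))
      · rw [abs_mul, abs_of_pos hv0']
      · rw [abs_mul]; exact mul_le_mul_of_nonneg_right h1 (abs_nonneg _)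
      · rw [abs_mul]; exact mul_le_mul_of_nonneg_right h2 (abs_nonneg _)
    have a2 := mul_le_mul_of_nonneg_left a1 hD0.le
    have a3 := mul_le_mul_of_nonneg_left hDr hv0'.le
    have a4 := mul_le_mul_of_nonneg_left hb1 hδ
    have a5 := mul_le_mul_of_nonneg_left hb2 hδ
    nlinarith
  have hzz : ((v 0 * z0 + v 1 * z1 + v 2 * z2 : ℤ) : ℝ) = D * ((v 0 : ℝ) * p0 + v 1 * p1 + v 2 * p2) := by
    push_cast
    rw [hz0, hz1, hz2]; ring
  have hzabs : |((v 0 * z0 + v 1 * z1 + v 2 * z2 : ℤ) : ℝ)| < 1 := by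
    rw [hzz, abs_mul, abs_of_pos hD0]; exact hS
  have hz : v 0 * z0 + v 1 * z1 + v 2 * z2 = 0 := by
    rw [← Int.abs_lt_one_iff]
    exact_mod_cast hzabs
  rw [hz, Int.cast_zero] at hzz
  exact (mul_eq_zero.1 hzz.symm).resolve_left hD0.ne'

lemma pu_rec (A : ℤ) (n : ℕ) : pu A (n + 2) = 2 * A * pu A (n + 1) - pu A n := by
  rw [pu_succ, py_succ, pu_succ]; ring

lemma pu_mod6 (N : ℤ) (n : ℕ) : ∃ e f : ℤ, (4 * N + 1) ∣ pu (2 * N + 1) n - e ∧ (4 * N + 1) ∣ pu (2 * N + 1) (n + 1) - f ∧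
    ((e = 0 ∧ f = 1) ∨ (e = 1 ∧ f = 1) ∨ (e = 1 ∧ f = 0) ∨ (e = 0 ∧ f = -1) ∨ (e = -1 ∧ f = -1) ∨ (e = -1 ∧ f = 0)) := by
  induction n with
  | zero => exact ⟨0, 1, by simp [pu_zero], by simp [pu_one], by simp⟩
  | succ n ih =>
    obtain ⟨e, f, he, hf, h⟩ := ih
    refine ⟨f, f - e, hf, ?_, by omega⟩
    rw [pu_rec]
    obtain ⟨a, ha⟩ := he
    obtain ⟨b, hb⟩ := hf
    refine ⟨pu (2 * N + 1) (n + 1) + b - a, ?_⟩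
    linear_combination hb - ha

lemma pu_modB (N : ℤ) (m : ℕ) : (4 * N + 1) ∣ pu (8 * N + 1) m + (-1) ^ m * m ∧
    (4 * N + 1) ∣ pu (8 * N + 1) (m + 1) + (-1) ^ (m + 1) * (m + 1) := by
  induction m with
  | zero => simp [pu_zero, pu_one]
  | succ m ih =>
    obtain ⟨⟨a, ha⟩, ⟨b, hb⟩⟩ := ih
    refine ⟨⟨b, by push_cast; exact hb⟩, ⟨4 * pu (8 * N + 1) (m + 1) - 2 * b - a, ?_⟩⟩
    rw [pu_rec]
    push_cast
    rw [pow_succ, pow_succ] at *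
    linear_combination (-2) * hb - ha

lemma pu_lower (N : ℤ) (hN : 1 ≤ N) (m : ℕ) : (4 * N) ^ m ≤ pu (8 * N + 1) (m + 1) := by
  induction m with
  | zero => simp [pu_one]
  | succ m ih =>
    rw [pu_succ, pow_succ]
    obtain ⟨h1, h2⟩ := pp_pos (8 * N + 1) (by linarith) (m + 1)
    nlinarith

lemma m_lower (N z0 : ℤ) (hN : 78408 ≤ N) (hz0 : 0 < z0) (hz : z0 ^ 2 = 3 * N + 1) (n m : ℕ) (hm : 1 ≤ m)
    (h : pu (2 * N + 1) (2 * n) = 2 * z0 * pu (8 * N + 1) m) : 200 ≤ m := by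
  obtain ⟨e, f, he, -, hef⟩ := pu_mod6 N (2 * n)
  obtain ⟨hB, -⟩ := pu_modB N m
  have hd : (4 * N + 1) ∣ 2 * z0 * ((-1) ^ m * m) + e := by
    rw [h] at he
    obtain ⟨a, ha⟩ := hB
    obtain ⟨b, hb⟩ := he
    exact ⟨2 * z0 * a - b, by linear_combination 2 * z0 * ha - hb⟩
  have he' : -1 ≤ e ∧ e ≤ 1 := by omega
  have hm' : (1 : ℤ) ≤ m := by exact_mod_cast hm
  have hzm : 0 < z0 * m := by positivity
  have hge : 4 * N ≤ 2 * z0 * m := by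
    rcases neg_one_pow_eq_or ℤ m with hp | hp
    · rw [hp] at hd
      have := Int.le_of_dvd (by nlinarith) hd
      nlinarith
    · rw [hp] at hd
      have hd2 : (4 * N + 1) ∣ 2 * z0 * m - e := by
        obtain ⟨a, ha⟩ := hd
        exact ⟨-a, by linear_combination -ha⟩
      have := Int.le_of_dvd (by nlinarith) hd2
      nlinarith
  by_contra hc
  have hm2 : (m : ℤ) ≤ 199 := by exact_mod_cast (by omega : m ≤ 199)
  have h2 : 2 * N ≤ 199 * z0 := by nlinarith
  nlinarith

set_option maxRecDepth 20000 in
lemma five_a (k z0 : ℤ) (hk : 99 ≤ k) (hz0 : 0 < z0) (hz : z0 ^ 2 = 3 * (8 * k ^ 2) + 1) (n m : ℕ)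
    (hm : 1 ≤ m) (h : pu (2 * (8 * k ^ 2) + 1) (2 * n) = 2 * z0 * pu (8 * (8 * k ^ 2) + 1) m) : False := by
  have hN : 78408 ≤ 8 * k ^ 2 := by nlinarith
  generalize 8 * k ^ 2 = N at *
  have hm200 := m_lower N z0 hN hz0 hz n m hm h
  obtain ⟨m', rfl⟩ : ∃ m', m = m' + 1 := ⟨m - 1, by omega⟩
  have hSl := pu_lower N (by omega) m'
  have hT := pp_eq (8 * N + 1) (m' + 1)
  have hY := pp_eq (2 * N + 1) (2 * n)
  have hTp := (pp_pos (8 * N + 1) (by linarith) (m' + 1)).1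
  have hYp := (pp_pos (2 * N + 1) (by linarith) (2 * n)).1
  rw [h] at hY
  generalize pu (8 * N + 1) (m' + 1) = S at *
  generalize py (8 * N + 1) (m' + 1) = T at *
  generalize py (2 * N + 1) (2 * n) = Y at *
  obtain ⟨X, hXdef⟩ : ∃ X, X = 4 * N := ⟨_, rfl⟩
  rw [← hXdef] at hSl
  have hX : 313632 ≤ X := by omega
  have hS199 : X ^ 199 ≤ S := (pow_le_pow_right₀ (by omega) (by omega)).trans hSl
  clear hSl h
  have hXr : (313632 : ℝ) ≤ X := by exact_mod_cast hX
  have hX0 : (0 : ℝ) < X := by linarith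
  have hSr : (X : ℝ) ^ 199 ≤ S := by exact_mod_cast hS199
  have hS0 : (0 : ℝ) < S := lt_of_lt_of_le (by positivity) hSr
  have hz0r : (1 : ℝ) ≤ z0 := by exact_mod_cast hz0
  have hz0X : (z0 : ℝ) ≤ X := by
    have : z0 ≤ X := by nlinarith
    exact_mod_cast this
  have hTr : (1 : ℝ) ≤ T := by exact_mod_cast hTp
  have hYr : (1 : ℝ) ≤ Y := by exact_mod_cast hYp
  have hNr : (X : ℝ) = 4 * N := by exact_mod_cast hXdef
  -- choose the order
  have hXpow : (1 : ℝ) ≤ (X : ℝ) ^ 100 := one_le_pow₀ (by linarith)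
  have hbig : (1 : ℝ) ≤ S / 168 := by
    rw [le_div_iff₀ (by norm_num)]
    have : (X : ℝ) ^ 1 ≤ (X : ℝ) ^ 199 := pow_le_pow_right₀ (by linarith) (by norm_num)
    linarith
  obtain ⟨q, hq1, hq2⟩ := exists_nat_pow_near hbig (by linarith : (1 : ℝ) < 462 * X)
  have hq60 : 60 ≤ q := by
    by_contra hc
    have a1 : (462 * (X : ℝ)) ^ (q + 1) ≤ (462 * (X : ℝ)) ^ 60 := pow_le_pow_right₀ (by linarith) (by omega)
    have a2 : (462 * (X : ℝ)) ^ 60 ≤ ((X : ℝ) ^ 2) ^ 60 := pow_le_pow_left₀ (by linarith) (by nlinarith) _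
    have a3 : (X : ℝ) ^ 199 / 168 ≤ S / 168 := by linarith
    have a4 : (X : ℝ) ^ 199 = ((X : ℝ) ^ 2) ^ 60 * X ^ 79 := by
      rw [show (199 : ℕ) = 2 * 60 + 79 by norm_num, pow_add, pow_mul]
    have a5 : (168 : ℝ) ≤ (X : ℝ) ^ 79 := by
      have : (X : ℝ) ^ 1 ≤ (X : ℝ) ^ 79 := pow_le_pow_right₀ (by linarith) (by norm_num)
      linarith
    have a6 : (0 : ℝ) < ((X : ℝ) ^ 2) ^ 60 := by positivity
    have a7 : ((X : ℝ) ^ 2) ^ 60 * 168 ≤ (X : ℝ) ^ 199 := by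
      rw [a4]; exact mul_le_mul_of_nonneg_left a5 a6.le
    linarith
  clear hSr hS199 hXpow
  obtain ⟨ν, rfl⟩ : ∃ ν, q = ν + 1 := ⟨q - 1, by omega⟩
  have hQ : (0 : ℝ) < 2 * X * z0 * S := by positivity
  have hQS : (S : ℝ) * (2 * X * z0) = 2 * X * z0 * S := by ring
  -- closeness
  have close : ∀ (u w d : ℝ), 0 < u → 0 ≤ w → u ^ 2 - w ^ 2 = d → 0 ≤ d → d * S ≤ w → |u - w| ≤ 1 / S := by
    intro u w d hu hw hd hd0 hdw
    have hfac : (u - w) * (u + w) = d := by rw [← hd]; ring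
    have h0 : 0 ≤ u - w := by
      by_contra hc
      push Not at hc
      have : 0 < u + w := by linarith
      nlinarith
    rw [abs_of_nonneg h0, le_div_iff₀ hS0]
    have hw2 : w ≤ u + w := by linarith
    by_contra hc
    push Not at hc
    have h3 : 0 < u + w := by linarith
    have h4 : u + w < (u - w) * S * (u + w) := by nlinarith
    have h5 : (u - w) * S * (u + w) = d * S := by rw [← hfac]; ring
    linarith
  have hTr2 : (T : ℝ) ^ 2 = 1 + ((8 * N + 1) ^ 2 - 1) * S ^ 2 := by exact_mod_cast hT
  have hYr2 : (Y : ℝ) ^ 2 = 1 + ((2 * N + 1) ^ 2 - 1) * (2 * z0 * S) ^ 2 := by exact_mod_cast hY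
  have hR := rickert X hX ν (by omega) ![2 * X * z0 * S, z0 * T, 2 * Y] (by
      simp only [Matrix.cons_val_zero]; exact_mod_cast hQ) (1 / S) ?_ ?_
  · simp only [Matrix.cons_val_zero] at hR
    push_cast at hR
    have hpos : (0 : ℝ) < (462 * X) ^ (ν + 1) := by positivity
    have b1 : 42 * (1 / (S : ℝ)) * (462 * X) ^ (ν + 1) ≤ 1 / 4 := by
      rw [le_div_iff₀ (by norm_num)] at hq1
      have : 42 * (1 / (S : ℝ)) * (462 * X) ^ (ν + 1) = 42 * (462 * X) ^ (ν + 1) / S := by ring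
      rw [this, div_le_iff₀ hS0]; linarith
    have hS2 : (S : ℝ) ≤ 168 * (462 * X) ^ (ν + 1 + 1) := by
      rw [div_lt_iff₀ (by norm_num)] at hq2; linarith
    have b2 : (2 * (X : ℝ) * z0 * S) * (145 ^ (ν + 1) * (X : ℝ) ^ 2 / (X : ℝ) ^ (2 * (ν + 1))) ≤ 1 / 2 := by
      have c1 : 2 * (X : ℝ) * z0 * S ≤ 2 * X * X * (168 * (462 * X) ^ (ν + 1 + 1)) :=
        mul_le_mul (mul_le_mul_of_nonneg_left hz0X (by positivity)) hS2 hS0.le (by positivity)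
      have c2 : (310464 : ℝ) * X ^ 5 * 66990 ^ (ν + 1) ≤ X ^ (ν + 1) := by
        obtain ⟨r, hr⟩ : ∃ r, ν + 1 = 60 + r := ⟨ν + 1 - 60, by omega⟩
        rw [hr, pow_add, pow_add]
        have d1 : (66990 : ℝ) ^ r ≤ (X : ℝ) ^ r := pow_le_pow_left₀ (by norm_num) (by linarith) r
        have d2 : (66990 : ℝ) ^ 10 ≤ (X : ℝ) ^ 9 :=
          le_trans (by norm_num) (pow_le_pow_left₀ (by norm_num) hXr 9)
        have d3 : (66990 : ℝ) ^ 60 ≤ (X : ℝ) ^ 54 := by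
          have := pow_le_pow_left₀ (by norm_num) d2 6
          rw [← pow_mul, ← pow_mul] at this
          exact this
        have d4 : (310464 : ℝ) * X ^ 5 ≤ X ^ 6 := by
          have : (X : ℝ) ^ 6 = X * X ^ 5 := by ring
          rw [this]
          exact mul_le_mul_of_nonneg_right (by linarith) (by positivity)
        calc (310464 : ℝ) * X ^ 5 * (66990 ^ 60 * 66990 ^ r) ≤ X ^ 6 * (X ^ 54 * X ^ r) :=
              mul_le_mul d4 (mul_le_mul d3 d1 (by positivity) (by positivity)) (by positivity) (by positivity)
          _ = X ^ 60 * X ^ r := by ring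
      have hXp : (0 : ℝ) < (X : ℝ) ^ (2 * (ν + 1)) := by positivity
      refine (mul_le_mul_of_nonneg_right c1 (by positivity)).trans ?_
      rw [mul_div_assoc', div_le_iff₀ hXp]
      have e1 : (2 : ℝ) * X * X * (168 * (462 * X) ^ (ν + 1 + 1)) * (145 ^ (ν + 1) * X ^ 2) =
          (1 / 2) * (310464 * X ^ 5 * 66990 ^ (ν + 1)) * X ^ (ν + 1) := by
        have : (66990 : ℝ) ^ (ν + 1) = 462 ^ (ν + 1) * 145 ^ (ν + 1) := by rw [← mul_pow]; norm_num
        rw [this, pow_succ (462 * (X : ℝ)) (ν + 1), mul_pow]; ring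
      rw [e1, two_mul (ν + 1), pow_add (X : ℝ) (ν + 1) (ν + 1)]
      have := mul_le_mul_of_nonneg_right c2 (by positivity : (0 : ℝ) ≤ X ^ (ν + 1))
      linarith
    linarith
  · simp only [Matrix.cons_val_zero, Matrix.cons_val_one]
    push_cast
    apply close _ _ ((z0 : ℝ) ^ 2) (by positivity) (by positivity) _ (by positivity)
    · have h1 : (1 : ℝ) ≤ Real.sqrt (1 + 1 / X) := by
        rw [Real.one_le_sqrt]
        have : (0 : ℝ) < 1 / X := by positivity
        linarith
      have h2 : (z0 : ℝ) ^ 2 * S ≤ 2 * X * z0 * S := by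
        have : (z0 : ℝ) ^ 2 ≤ 2 * X * z0 := by nlinarith
        exact mul_le_mul_of_nonneg_right this hS0.le
      exact h2.trans (le_mul_of_one_le_right hQ.le h1)
    · rw [mul_pow _ (Real.sqrt _), Real.sq_sqrt (by positivity), mul_pow, hTr2]
      have : (2 * (X : ℝ) * z0 * S) ^ 2 * (1 + 1 / X) = 4 * X * (X + 1) * z0 ^ 2 * S ^ 2 := by
        field_simp; ring
      rw [this, hNr]; ring
  · simp only [Matrix.cons_val_zero, Matrix.cons_val]
    push_cast
    apply close _ _ 4 (by positivity) (by positivity) _ (by positivity)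
    · have h1 : (1 : ℝ) ≤ Real.sqrt (1 + 4 / X) := by
        rw [Real.one_le_sqrt]
        have : (0 : ℝ) < 4 / X := by positivity
        linarith
      have h2 : 4 * (S : ℝ) ≤ 2 * X * z0 * S := by
        have : (4 : ℝ) ≤ 2 * X * z0 := by nlinarith
        exact mul_le_mul_of_nonneg_right this hS0.le
      exact h2.trans (le_mul_of_one_le_right hQ.le h1)
    · rw [mul_pow _ (Real.sqrt _), Real.sq_sqrt (by positivity), mul_pow, hYr2]
      have : (2 * (X : ℝ) * z0 * S) ^ 2 * (1 + 4 / X) = 4 * X * (X + 4) * z0 ^ 2 * S ^ 2 := by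
        field_simp; ring
      rw [this, hNr]; ring

/-- If `{8k², 8k²+1, c, d}` is a `D(-8k²)`-quadruple of positive integers with `c < d`,
then `c = 1` and `d = 32k²+1`; moreover `k` is a term of the sequence
`k₁ = 1, k₂ = 10, k_{n+2} = 10 k_{n+1} - k_n`. -/
theorem stmt_0 (k c d : ℤ) (hk : 0 < k) (hc : 0 < c) (hd : 0 < d) (hcd : c < d)
    (hc1 : c ≠ 8 * k ^ 2) (hc2 : c ≠ 8 * k ^ 2 + 1)
    (hd1 : d ≠ 8 * k ^ 2) (hd2 : d ≠ 8 * k ^ 2 + 1)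
    (h12 : ∃ x : ℤ, 8 * k ^ 2 * (8 * k ^ 2 + 1) - 8 * k ^ 2 = x ^ 2)
    (h1c : ∃ x : ℤ, 8 * k ^ 2 * c - 8 * k ^ 2 = x ^ 2)
    (h2c : ∃ x : ℤ, (8 * k ^ 2 + 1) * c - 8 * k ^ 2 = x ^ 2)
    (h1d : ∃ x : ℤ, 8 * k ^ 2 * d - 8 * k ^ 2 = x ^ 2)
    (h2d : ∃ x : ℤ, (8 * k ^ 2 + 1) * d - 8 * k ^ 2 = x ^ 2)
    (hcd' : ∃ x : ℤ, c * d - 8 * k ^ 2 = x ^ 2) :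
    c = 1 ∧ d = 32 * k ^ 2 + 1 ∧ ∃ i : ℕ, k = kseq i := by
  refine assemble k c d hk hc hcd h1c h2c h1d h2d hcd' ?_
  intro z0 n m hz0 hz hm h
  rcases lt_or_ge k 99 with hlt | hge
  · exact five_b_final k z0 hk hlt n m hz hm h
  · exact five_a k z0 hge hz0 hz n m hm h
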